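/- arXiv:2410.12981 — 2 statements merged into one kernel-verified Lean document; each statement's English description precedes it below -/
import Mathlib

section
/- There exists d₀ such that for all d ≥ d₀ the following holds. Let n ≥ d+1 be an even integer and let G be an (n,d,λ)-graph with λ ≤ d/12. Then G admits a 1-factorization, i.e., its edge set can be partitioned into d perfect matchings. -/
open scoped Classical

section helpers
open Finset

lemma indep_count {ι L : Type*} [Fintype ι] [Fintype L] (S : Finset ι) (A B : Finset (ι → L))
    (hA : ∀ ω ω' : ι → L, (∀ i ∈ S, ω i = ω' i) → (ω ∈ A → ω' ∈ A))
    (hB : ∀ ω ω' : ι → L, (∀ i ∉ S, ω i = ω' i) → (ω ∈ B → ω' ∈ B)) :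
    (A ∩ B).card * Fintype.card (ι → L) = A.card * B.card := by
  rw [← Finset.card_univ, ← Finset.card_product, ← Finset.card_product]
  let mix : (ι → L) → (ι → L) → (ι → L) := fun a b i => if i ∈ S then a i else b i
  have m1 : ∀ a b, ∀ i ∈ S, mix a b i = a i := fun a b i hi => by simp [mix, hi]
  have m2 : ∀ a b, ∀ i ∉ S, mix a b i = b i := fun a b i hi => by simp [mix, hi]
  have m3 : ∀ a b, mix (mix a b) (mix b a) = a := by
    intro a b; funext i; by_cases hi : i ∈ S <;> simp [mix, hi]
  refine Finset.card_bij' (fun x _ => (mix x.1 x.2, mix x.2 x.1)) (fun x _ => (mix x.1 x.2, mix x.2 x.1)) ?_ ?_ ?_ ?_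
  · rintro ⟨a, b⟩ h
    simp only [mem_product, mem_inter, mem_univ, and_true] at h ⊢
    exact ⟨hA a _ (fun i hi => (m1 a b i hi).symm) h.1, hB a _ (fun i hi => (m2 b a i hi).symm) h.2⟩
  · rintro ⟨a, b⟩ h
    simp only [mem_product, mem_inter, mem_univ, and_true] at h ⊢
    exact ⟨hA a _ (fun i hi => (m1 a b i hi).symm) h.1, hB b _ (fun i hi => (m2 a b i hi).symm) h.2⟩
  · rintro ⟨a, b⟩ h; simp [m3]
  · rintro ⟨a, b⟩ h; simp [m3]

lemma lll {V ι L : Type*} [Fintype V] [Fintype ι] [Fintype L] [Nonempty L]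
    (B : V → Finset (ι → L)) (S : V → Finset ι)
    (hdep : ∀ v, ∀ ω ω' : ι → L, (∀ i ∈ S v, ω i = ω' i) → (ω ∈ B v → ω' ∈ B v))
    (p : ℝ) (hp0 : 0 ≤ p) (hp4 : 4 * p ≤ 1)
    (hp : ∀ v, ((B v).card : ℝ) ≤ p * Fintype.card (ι → L)) (D : ℕ)
    (hD : ∀ v, (univ.filter (fun w => ¬ Disjoint (S w) (S v))).card ≤ D) (h : 4 * p * D ≤ 1) :
    ∃ ω, ∀ v, ω ∉ B v := by
  let good : Finset V → Finset (ι → L) := fun T => univ.filter (fun ω => ∀ w ∈ T, ω ∉ B w)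
  have hN : (0 : ℝ) < Fintype.card (ι → L) := by
    exact_mod_cast Fintype.card_pos
  have key : ∀ k : ℕ, ∀ T : Finset V, T.card = k →
      (0 < ((good T).card : ℝ) ∧ ∀ v, ((B v ∩ good T).card : ℝ) ≤ 2 * p * (good T).card) := by
    intro k
    induction k using Nat.strong_induction_on with
    | _ k ih =>
      intro T hT
      have pos : 0 < ((good T).card : ℝ) := by
        rcases T.eq_empty_or_nonempty with rfl | ⟨w, hw⟩
        · have : good ∅ = univ := by simp [good]
          rw [this, Finset.card_univ]; exact hN
        · have hlt : (T.erase w).card < k := by rw [← hT]; exact Finset.card_erase_lt_of_mem hw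
          obtain ⟨h1, h2⟩ := ih _ hlt (T.erase w) rfl
          have h3 := h2 w
          have h4 : good (T.erase w) ⊆ good T ∪ (B w ∩ good (T.erase w)) := by
            intro ω hω
            simp only [good, mem_union, mem_inter, mem_filter, mem_univ, true_and] at hω ⊢
            by_cases hb : ω ∈ B w
            · right; exact ⟨hb, hω⟩
            · left; intro x hx
              by_cases hxw : x = w
              · rw [hxw]; exact hb
              · exact hω x (Finset.mem_erase.2 ⟨hxw, hx⟩)
          have h5 := (Finset.card_le_card h4).trans (Finset.card_union_le _ _)
          have h6 : ((good (T.erase w)).card : ℝ) ≤ (good T).card + (B w ∩ good (T.erase w)).card := by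
            exact_mod_cast h5
          nlinarith
      refine ⟨pos, fun v => ?_⟩
      let T1 := T.filter (fun w => ¬ Disjoint (S w) (S v))
      let T2 := T.filter (fun w => Disjoint (S w) (S v))
      have hsub : good T ⊆ good T2 := by
        intro ω hω
        simp only [good, mem_filter, mem_univ, true_and, T2] at hω ⊢
        exact fun w hw => hω w hw.1
      have hind : ((B v ∩ good T2).card : ℝ) ≤ p * (good T2).card := by
        have := indep_count (S v) (B v) (good T2) (hdep v) (by
          intro ω ω' hh hω
          simp only [good, mem_filter, mem_univ, true_and, T2] at hω ⊢
          intro w hw hmem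
          refine hω w hw (hdep w ω' ω ?_ hmem)
          intro i hi
          exact (hh i (fun hi' => (Finset.disjoint_left.1 hw.2 hi) hi')).symm)
        have h' : ((B v ∩ good T2).card : ℝ) * Fintype.card (ι → L) = (B v).card * (good T2).card := by
          exact_mod_cast this
        have h2 : ((B v).card : ℝ) * (good T2).card ≤ (p * Fintype.card (ι → L)) * (good T2).card :=
          mul_le_mul_of_nonneg_right (hp v) (by positivity)
        rw [← h'] at h2
        have h3 : ((B v ∩ good T2).card : ℝ) * Fintype.card (ι → L) ≤ (p * (good T2).card) * Fintype.card (ι → L) := by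
          linarith
        exact le_of_mul_le_mul_right h3 hN
      have hmono : ((B v ∩ good T).card : ℝ) ≤ (B v ∩ good T2).card := by
        exact_mod_cast Finset.card_le_card (Finset.inter_subset_inter_left hsub)
      have hhalf : ((good T2).card : ℝ) ≤ 2 * (good T).card := by
        rcases T1.eq_empty_or_nonempty with he | hne
        · have : T2 = T := by
            apply Finset.filter_true_of_mem
            intro w hw
            by_contra hc
            have : w ∈ T1 := Finset.mem_filter.2 ⟨hw, hc⟩
            rw [he] at this; simp at this
          rw [this]; linarith
        · obtain ⟨w0, hw0⟩ := hne
          have hlt : T2.card < k := by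
            rw [← hT]
            apply Finset.card_lt_card
            refine ⟨Finset.filter_subset _ _, fun hh => ?_⟩
            have h1 := Finset.mem_filter.1 hw0
            exact h1.2 (Finset.mem_filter.1 (hh h1.1)).2
          obtain ⟨g1, g2⟩ := ih _ hlt T2 rfl
          have hcov : good T2 ⊆ good T ∪ T1.biUnion (fun w => B w ∩ good T2) := by
            intro ω hω
            by_cases hg : ω ∈ good T
            · exact Finset.mem_union_left _ hg
            · apply Finset.mem_union_right
              have hg' : ∃ w ∈ T, ω ∈ B w := by
                by_contra hc
                push Not at hc
                exact hg (by simp only [good, mem_filter, mem_univ, true_and]; exact hc)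
              obtain ⟨w, hw, hwb⟩ := hg'
              refine Finset.mem_biUnion.2 ⟨w, ?_, Finset.mem_inter.2 ⟨hwb, hω⟩⟩
              refine Finset.mem_filter.2 ⟨hw, fun hd => ?_⟩
              have hω' := (Finset.mem_filter.1 hω).2
              exact hω' w (Finset.mem_filter.2 ⟨hw, hd⟩) hwb
          have c1 := (Finset.card_le_card hcov).trans (Finset.card_union_le _ _)
          have c2 : (T1.biUnion (fun w => B w ∩ good T2)).card ≤ ∑ w ∈ T1, (B w ∩ good T2).card :=
            Finset.card_biUnion_le
          have c3 : ((good T2).card : ℝ) ≤ (good T).card + ∑ w ∈ T1, ((B w ∩ good T2).card : ℝ) := by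
            exact_mod_cast c1.trans (Nat.add_le_add_left c2 _)
          have c4 : ∑ w ∈ T1, ((B w ∩ good T2).card : ℝ) ≤ T1.card * (2 * p * (good T2).card) := by
            have := Finset.sum_le_card_nsmul T1 (fun w => ((B w ∩ good T2).card : ℝ)) _ (fun w _ => g2 w)
            simpa using this
          have c5 : (T1.card : ℝ) ≤ D := by
            have : T1.card ≤ D := (Finset.card_le_card (Finset.filter_subset_filter _ (Finset.subset_univ T))).trans (hD v)
            exact_mod_cast this
          have c6 : (T1.card : ℝ) * (2 * p * (good T2).card) ≤ D * (2 * p * (good T2).card) :=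
            mul_le_mul_of_nonneg_right c5 (by positivity)
          nlinarith
      nlinarith
  obtain ⟨h1, -⟩ := key _ univ rfl
  have h2 : 0 < (good univ).card := by exact_mod_cast h1
  obtain ⟨ω, hω⟩ := Finset.card_pos.1 h2
  exact ⟨ω, fun v => (Finset.mem_filter.1 hω).2 v (mem_univ v)⟩

lemma exp_lin {s c x : ℝ} (hc : 0 ≤ c) (hx : |x| ≤ c) :
    c * Real.exp (s * x) ≤ c * Real.cosh (s * c) + x * Real.sinh (s * c) := by
  rcases hc.eq_or_lt with rfl | hc
  · have : x = 0 := by simpa using hx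
    simp [this]
  obtain ⟨h1, h2⟩ := abs_le.1 hx
  have := convexOn_exp.2 (Set.mem_univ (s * c)) (Set.mem_univ (-(s * c)))
    (show 0 ≤ (c + x) / (2 * c) from div_nonneg (by linarith) (by linarith))
    (show 0 ≤ (c - x) / (2 * c) from div_nonneg (by linarith) (by linarith))
    (by field_simp; ring)
  have e1 : ((c + x) / (2 * c)) • (s * c) + ((c - x) / (2 * c)) • (-(s * c)) = s * x := by
    simp only [smul_eq_mul]; field_simp; ring
  rw [e1] at this
  have h3 := mul_le_mul_of_nonneg_left this hc.le
  refine h3.trans (le_of_eq ?_)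
  rw [Real.cosh_eq, Real.sinh_eq]
  simp only [smul_eq_mul]; field_simp; ring

lemma mgf_one {L : Type*} [Fintype L] (g : L → ℝ) (c s : ℝ) (hc : 0 ≤ c) (hg : ∀ x, |g x| ≤ c)
    (h0 : ∑ x, g x = 0) : ∑ x, Real.exp (s * g x) ≤ Fintype.card L * Real.exp (s ^ 2 * c ^ 2 / 2) := by
  rcases hc.eq_or_lt with rfl | hc
  · have : ∀ x, g x = 0 := fun x => by simpa using hg x
    simp [this]
  have h1 : ∑ x, c * Real.exp (s * g x) ≤ ∑ x, (c * Real.cosh (s * c) + g x * Real.sinh (s * c)) :=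
    Finset.sum_le_sum (fun x _ => exp_lin hc.le (hg x))
  rw [← Finset.mul_sum, Finset.sum_add_distrib, ← Finset.sum_mul, ← Finset.sum_mul, h0] at h1
  simp only [sum_const, card_univ, nsmul_eq_mul, zero_mul, add_zero] at h1
  have h2 : ∑ x, Real.exp (s * g x) ≤ Fintype.card L * Real.cosh (s * c) := by
    have : c * ∑ x, Real.exp (s * g x) ≤ c * (Fintype.card L * Real.cosh (s * c)) := by linarith
    exact le_of_mul_le_mul_left this hc
  refine h2.trans (mul_le_mul_of_nonneg_left ?_ (by positivity))
  have := Real.cosh_le_exp_half_sq (s * c)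
  rwa [mul_pow] at this

lemma hoeffding {ι L : Type*} [Fintype ι] [Fintype L] (g : ι → L → ℝ) (c : ι → ℝ)
    (hc : ∀ i, 0 ≤ c i) (hg : ∀ i x, |g i x| ≤ c i) (h0 : ∀ i, ∑ x, g i x = 0) (C t : ℝ) (hC : 0 < C)
    (hcC : ∑ i, c i ^ 2 ≤ C) (ht : 0 ≤ t) :
    ((univ.filter (fun ω : ι → L => t ≤ ∑ i, g i (ω i))).card : ℝ)
      ≤ Real.exp (-(t ^ 2 / (2 * C))) * Fintype.card (ι → L) := by
  set s : ℝ := t / C with hs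
  have hs0 : 0 ≤ s := by positivity
  have h1 : ∑ ω : ι → L, Real.exp (s * ∑ i, g i (ω i)) ≤ Fintype.card (ι → L) * Real.exp (s ^ 2 * C / 2) := by
    have e1 : ∑ ω : ι → L, Real.exp (s * ∑ i, g i (ω i)) = ∏ i, ∑ x, Real.exp (s * g i x) := by
      rw [Finset.prod_univ_sum]
      simp only [Fintype.piFinset_univ]
      refine Finset.sum_congr rfl (fun ω _ => ?_)
      rw [Finset.mul_sum, Real.exp_sum]
    rw [e1]
    have h2 : ∏ i, ∑ x, Real.exp (s * g i x) ≤ ∏ i : ι, (Fintype.card L * Real.exp (s ^ 2 * c i ^ 2 / 2)) :=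
      Finset.prod_le_prod (fun i _ => Finset.sum_nonneg (fun x _ => (Real.exp_pos _).le))
        (fun i _ => mgf_one (g i) (c i) s (hc i) (hg i) (h0 i))
    refine h2.trans ?_
    rw [Finset.prod_mul_distrib, ← Real.exp_sum]
    simp only [prod_const, card_univ, Fintype.card_fun, Nat.cast_pow]
    apply mul_le_mul_of_nonneg_left _ (by positivity)
    apply Real.exp_le_exp.2
    rw [← Finset.sum_div, ← Finset.mul_sum]
    have : s ^ 2 * ∑ i, c i ^ 2 ≤ s ^ 2 * C := mul_le_mul_of_nonneg_left hcC (by positivity)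
    linarith
  have h3 : ((univ.filter (fun ω : ι → L => t ≤ ∑ i, g i (ω i))).card : ℝ) * Real.exp (s * t)
      ≤ ∑ ω : ι → L, Real.exp (s * ∑ i, g i (ω i)) := by
    calc _ = ∑ ω ∈ univ.filter (fun ω : ι → L => t ≤ ∑ i, g i (ω i)), Real.exp (s * t) := by simp
      _ ≤ ∑ ω ∈ univ.filter (fun ω : ι → L => t ≤ ∑ i, g i (ω i)), Real.exp (s * ∑ i, g i (ω i)) := by
          apply Finset.sum_le_sum
          intro ω hω
          exact Real.exp_le_exp.2 (mul_le_mul_of_nonneg_left (Finset.mem_filter.1 hω).2 hs0)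
      _ ≤ _ := Finset.sum_le_sum_of_subset_of_nonneg (Finset.subset_univ _) (fun _ _ _ => (Real.exp_pos _).le)
  have h4 := h3.trans h1
  have e2 : Real.exp (s ^ 2 * C / 2) = Real.exp (-(t ^ 2 / (2 * C))) * Real.exp (s * t) := by
    rw [← Real.exp_add]; congr 1; rw [hs]; field_simp; ring
  rw [e2, ← mul_assoc] at h4
  have := le_of_mul_le_mul_right h4 (Real.exp_pos _)
  linarith

def lab {V ι : Type*} {M : ℕ} (e : V ≃ ι × Bool) (ω : ι → (Fin M → Bool)) (v : V) : Fin M → Bool :=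
  fun j => xor (ω (e v).1 j) (e v).2

def dl {V ι : Type*} {M : ℕ} (e : V ≃ ι × Bool) (ω : ι → (Fin M → Bool)) (v u : V) : Fin M → Bool :=
  fun j => xor (lab e ω v j) (lab e ω u j)

lemma pair_card {V ι : Type*} [Fintype V] (e : V ≃ ι × Bool) (p : ι) :
    (univ.filter (fun u => (e u).1 = p)).card ≤ 2 := by
  have : univ.filter (fun u => (e u).1 = p) ⊆ {e.symm (p, true), e.symm (p, false)} := by
    intro u hu
    have h := (mem_filter.1 hu).2
    simp only [mem_insert, mem_singleton]
    rcases hb : (e u).2 with _ | _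
    · right; rw [Equiv.eq_symm_apply]; exact Prod.ext h hb
    · left; rw [Equiv.eq_symm_apply]; exact Prod.ext h hb
  exact (card_le_card this).trans (card_le_two)

lemma shift_count {M : ℕ} (Q : Finset (Fin M → Bool)) (b : Bool) :
    ∑ x : Fin M → Bool, ((if (fun j => xor (x j) b) ∈ Q then (1 : ℝ) else 0) - (Q.card : ℝ) / 2 ^ M) = 0 := by
  have inv : Function.Involutive (fun (x : Fin M → Bool) (j : Fin M) => xor (x j) b) := by
    intro x; funext j; simp
  have := Equiv.sum_comp inv.toPerm (fun x => (if x ∈ Q then (1 : ℝ) else 0) - (Q.card : ℝ) / 2 ^ M)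
  have h2 : ∑ x : Fin M → Bool, ((if x ∈ Q then (1 : ℝ) else 0) - (Q.card : ℝ) / 2 ^ M) = 0 := by
    rw [Finset.sum_sub_distrib]
    simp
    field_simp
    ring
  exact this.trans h2

lemma conc {V ι : Type*} [Fintype V] [Fintype ι] {M : ℕ} (e : V ≃ ι × Bool) (G : SimpleGraph V) (d : ℕ)
    (hd : 1 ≤ d) (v : V) (hdeg : (univ.filter (G.Adj v)).card = d) (Q : Finset (Fin M → Bool)) (E : ℝ) (hE : 1 ≤ E) :
    ((univ.filter (fun ω : ι → (Fin M → Bool) =>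
        E ≤ |((univ.filter (fun u => G.Adj v u ∧ dl e ω v u ∈ Q)).card : ℝ) - d * ((Q.card : ℝ) / 2 ^ M)|)).card : ℝ)
      ≤ 2 * Real.exp (-((E - 1) ^ 2 / (4 * d))) * Fintype.card (ι → (Fin M → Bool)) := by
  set q : ℝ := (Q.card : ℝ) / 2 ^ M with hq
  have hq0 : 0 ≤ q := by positivity
  have hq1 : q ≤ 1 := by
    rw [hq, div_le_one (by positivity)]
    have := Finset.card_le_univ Q
    simp at this
    exact_mod_cast this
  set p0 := (e v).1 with hp0
  let N : Finset V := univ.filter (G.Adj v)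
  let tm : V → (Fin M → Bool) → ℝ := fun u x =>
    (if (fun j => xor (x j) (xor (e u).2 (e v).2)) ∈ Q then (1 : ℝ) else 0) - q
  have tmb : ∀ u x, |tm u x| ≤ 1 := by
    intro u x
    simp only [tm]
    split_ifs <;> rw [abs_le] <;> constructor <;> linarith
  let g : ι → (Fin M → Bool) → ℝ := fun p x =>
    if p = p0 then 0 else ∑ u ∈ N.filter (fun u => (e u).1 = p), tm u x
  let c : ι → ℝ := fun p => ((N.filter (fun u => (e u).1 = p)).card : ℝ)
  have hc : ∀ p, 0 ≤ c p := fun p => Nat.cast_nonneg _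
  have hg : ∀ p x, |g p x| ≤ c p := by
    intro p x
    by_cases h : p = p0
    · simp [g, h, hc]
    · simp only [g, h, if_false]
      refine (Finset.abs_sum_le_sum_abs _ _).trans ?_
      refine (Finset.sum_le_card_nsmul _ _ 1 (fun u _ => tmb u x)).trans ?_
      simp [c]
  have h0 : ∀ p, ∑ x, g p x = 0 := by
    intro p
    by_cases h : p = p0
    · simp [g, h]
    · simp only [g, h, if_false]
      rw [Finset.sum_comm]
      exact Finset.sum_eq_zero (fun u _ => shift_count Q _)
  have hcs : ∑ p, c p = d := by
    have := Finset.card_eq_sum_card_fiberwise (s := N) (t := univ) (f := fun u => (e u).1) (fun _ _ => by simp)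
    rw [← hdeg]
    simp only [c]
    exact_mod_cast this.symm
  have hc2 : ∀ p, c p ≤ 2 := by
    intro p
    have : (N.filter (fun u => (e u).1 = p)).card ≤ 2 :=
      (card_le_card (Finset.filter_subset_filter _ (Finset.subset_univ _))).trans (pair_card e p)
    simp only [c]
    exact_mod_cast this
  have hcC : ∑ p, c p ^ 2 ≤ 2 * d := by
    rw [← hcs, Finset.mul_sum]
    exact Finset.sum_le_sum (fun p _ => by nlinarith [hc p, hc2 p])
  have hdpos : (0 : ℝ) < 2 * d := by
    have : (1 : ℝ) ≤ d := by exact_mod_cast hd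
    linarith
  have H1 := hoeffding g c hc hg h0 (2 * d) (E - 1) hdpos hcC (by linarith)
  have H2 := hoeffding (fun p x => - g p x) c hc (fun p x => by rw [abs_neg]; exact hg p x)
    (fun p => by rw [Finset.sum_neg_distrib, h0 p, neg_zero]) (2 * d) (E - 1) hdpos hcC (by linarith)
  let φ : (ι → (Fin M → Bool)) → (ι → (Fin M → Bool)) := fun ω p =>
    if p = p0 then ω p0 else fun j => xor (ω p j) (ω p0 j)
  have φinv : Function.Involutive φ := by
    intro ω
    funext p
    by_cases h : p = p0
    · simp [φ, h]
    · simp [φ, h]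
  have main : ∀ ω, |(((univ.filter (fun u => G.Adj v u ∧ dl e ω v u ∈ Q)).card : ℝ) - d * q) - ∑ p, g p (φ ω p)| ≤ 1 := by
    intro ω
    have e1 : ((univ.filter (fun u => G.Adj v u ∧ dl e ω v u ∈ Q)).card : ℝ) - d * q
        = ∑ u ∈ N, ((if dl e ω v u ∈ Q then (1 : ℝ) else 0) - q) := by
      rw [Finset.sum_sub_distrib, ← Finset.sum_filter, ← hdeg, Finset.filter_filter]
      simp [N]
    have e2 : ∑ u ∈ N, ((if dl e ω v u ∈ Q then (1 : ℝ) else 0) - q)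
        = ∑ p, ∑ u ∈ N.filter (fun u => (e u).1 = p), ((if dl e ω v u ∈ Q then (1 : ℝ) else 0) - q) := by
      exact (Finset.sum_fiberwise N (fun u => (e u).1) _).symm
    rw [e1, e2, ← Finset.sum_sub_distrib]
    rw [Finset.sum_eq_single p0]
    · simp only [g, if_true, sub_zero]
      refine (Finset.abs_sum_le_sum_abs _ _).trans ?_
      refine (Finset.sum_le_card_nsmul _ _ 1 (fun u _ => ?_)).trans ?_
      · split_ifs <;> rw [abs_le] <;> constructor <;> linarith
      · have : (N.filter (fun u => (e u).1 = p0)).card ≤ 1 := by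
          rw [Finset.card_le_one]
          intro a ha b hb
          simp only [N, mem_filter, mem_univ, true_and] at ha hb
          have ha2 : (e a).2 ≠ (e v).2 := fun h => ha.1.ne (e.injective (Prod.ext ha.2 h)).symm
          have hb2 : (e b).2 ≠ (e v).2 := fun h => hb.1.ne (e.injective (Prod.ext hb.2 h)).symm
          apply e.injective
          refine Prod.ext (ha.2.trans hb.2.symm) ?_
          revert ha2 hb2
          cases (e a).2 <;> cases (e b).2 <;> cases (e v).2 <;> simp
        simpa using this
    · intro p _ hp
      rw [sub_eq_zero]
      simp only [g, hp, if_false]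
      refine Finset.sum_congr rfl (fun u hu => ?_)
      have hu2 := (mem_filter.1 hu).2
      have : dl e ω v u = (fun j => xor (φ ω p j) (xor (e u).2 (e v).2)) := by
        funext j
        simp only [dl, lab, φ, hp, if_false, hu2, ← hp0]
        cases ω p j <;> cases ω p0 j <;> cases (e u).2 <;> cases (e v).2 <;> rfl
      simp only [tm, this]
    · simp
  have hsub : (univ.filter (fun ω : ι → (Fin M → Bool) =>
        E ≤ |((univ.filter (fun u => G.Adj v u ∧ dl e ω v u ∈ Q)).card : ℝ) - d * q|)) ⊆
      (univ.filter (fun ω : ι → (Fin M → Bool) => E - 1 ≤ ∑ p, g p (ω p))).image φ ∪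
      (univ.filter (fun ω : ι → (Fin M → Bool) => E - 1 ≤ ∑ p, - g p (ω p))).image φ := by
    intro ω hω
    have h1 := (mem_filter.1 hω).2
    have h2 := abs_le.1 (main ω)
    rw [Finset.mem_union, Finset.mem_image, Finset.mem_image]
    rcases le_abs.1 h1 with h | h
    · left
      refine ⟨φ ω, mem_filter.2 ⟨mem_univ _, ?_⟩, φinv ω⟩
      linarith
    · right
      refine ⟨φ ω, mem_filter.2 ⟨mem_univ _, ?_⟩, φinv ω⟩
      rw [Finset.sum_neg_distrib]
      linarith
  have k1 := (card_le_card hsub).trans (card_union_le _ _)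
  have k2 := k1.trans (Nat.add_le_add card_image_le card_image_le)
  have k3 : ((univ.filter (fun ω : ι → (Fin M → Bool) =>
        E ≤ |((univ.filter (fun u => G.Adj v u ∧ dl e ω v u ∈ Q)).card : ℝ) - d * q|)).card : ℝ) ≤ _ :=
    Nat.cast_le.2 k2
  rw [Nat.cast_add] at k3
  have e4 : (2 : ℝ) * (2 * d) = 4 * d := by ring
  rw [e4] at H1 H2
  linarith

lemma mono_count {V ι : Type*} [Fintype V] [Fintype ι] {M : ℕ} (hM : 1 ≤ M) (e : V ≃ ι × Bool) (u v : V) (huv : u ≠ v) :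
    ((univ.filter (fun ω : ι → (Fin M → Bool) => lab e ω u = lab e ω v)).card : ℝ)
      ≤ 1 / 2 ^ M * Fintype.card (ι → (Fin M → Bool)) := by
  rw [one_div, ← div_eq_inv_mul, le_div_iff₀ (by positivity)]
  have hL : Fintype.card (Fin M → Bool) = 2 ^ M := by simp
  have key : (univ.filter (fun ω : ι → (Fin M → Bool) => lab e ω u = lab e ω v)).card * 2 ^ M ≤ Fintype.card (ι → (Fin M → Bool)) := by
    by_cases hp : (e u).1 = (e v).1
    · have : univ.filter (fun ω : ι → (Fin M → Bool) => lab e ω u = lab e ω v) = ∅ := by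
        rw [Finset.filter_eq_empty_iff]
        intro ω _ h
        have h1 := congrFun h ⟨0, hM⟩
        simp only [lab, hp] at h1
        apply huv
        apply e.injective
        refine Prod.ext hp ?_
        revert h1
        cases ω (e v).1 ⟨0, hM⟩ <;> cases (e u).2 <;> cases (e v).2 <;> simp
      rw [this]; simp
    · rw [← hL, ← Finset.card_univ, ← Finset.card_univ (α := ι → (Fin M → Bool)), ← Finset.card_product]
      refine Finset.card_le_card_of_injOn (fun x => Function.update x.1 (e u).1 x.2) (fun _ _ => by simp) ?_
      rintro ⟨ω, x⟩ h1 ⟨ω', x'⟩ h2 heq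
      simp only [coe_product, coe_filter, mem_univ, true_and, coe_univ, Set.mem_prod, Set.mem_ofPred_eq, Set.mem_univ, and_true] at h1 h2
      simp only at heq
      have hne : ∀ p, p ≠ (e u).1 → ω p = ω' p := by
        intro p hp'
        have := congrFun heq p
        simpa [Function.update_of_ne hp'] using this
      have hx : x = x' := by
        have := congrFun heq (e u).1
        simpa using this
      have hv := hne _ (Ne.symm hp)
      have : ω = ω' := by
        funext p
        by_cases hpp : p = (e u).1
        · subst hpp
          funext j
          have a1 := congrFun h1 j
          have a2 := congrFun h2 j
          simp only [lab, ← hv] at a1 a2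
          rw [← a1] at a2
          revert a2
          cases ω (e u).1 j <;> cases ω' (e u).1 j <;> cases (e u).2 <;> simp
        · exact hne p hpp
      rw [this, hx]
  exact_mod_cast key

lemma labels_exist {V ι J : Type*} [Fintype V] [Fintype ι] [Fintype J] {M : ℕ} (hM : 1 ≤ M) (e : V ≃ ι × Bool)
    (G : SimpleGraph V) (d : ℕ) (hd : 1 ≤ d) (hdeg : ∀ v, (univ.filter (G.Adj v)).card = d)
    (Q : J → Finset (Fin M → Bool)) (E : ℝ) (hE : 1 ≤ E)
    (hnum : 4 * (Fintype.card J * (2 * Real.exp (-((E - 1) ^ 2 / (4 * d)))) + d * (1 / 2 ^ M)) * (2 * (d + 1) ^ 2) ≤ 1) :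
    ∃ ω : ι → (Fin M → Bool), (∀ v u, G.Adj v u → lab e ω u ≠ lab e ω v) ∧
      ∀ v j, |((univ.filter (fun u => G.Adj v u ∧ dl e ω v u ∈ Q j)).card : ℝ) - d * (((Q j).card : ℝ) / 2 ^ M)| < E := by
  set p : ℝ := Fintype.card J * (2 * Real.exp (-((E - 1) ^ 2 / (4 * d)))) + d * (1 / 2 ^ M) with hp
  have hp0 : 0 ≤ p := by positivity
  let N : V → Finset V := fun v => univ.filter (G.Adj v)
  let B1 : V → J → Finset (ι → (Fin M → Bool)) := fun v j => univ.filter (fun ω =>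
        E ≤ |((univ.filter (fun u => G.Adj v u ∧ dl e ω v u ∈ Q j)).card : ℝ) - d * (((Q j).card : ℝ) / 2 ^ M)|)
  let B2 : V → V → Finset (ι → (Fin M → Bool)) := fun v u => univ.filter (fun ω => lab e ω u = lab e ω v)
  let B : V → Finset (ι → (Fin M → Bool)) := fun v => univ.biUnion (B1 v) ∪ (N v).biUnion (B2 v)
  let S : V → Finset ι := fun v => (insert v (N v)).image (fun u => (e u).1)
  have hlab : ∀ v, ∀ ω ω' : ι → (Fin M → Bool), (∀ i ∈ S v, ω i = ω' i) → ∀ u ∈ insert v (N v), lab e ω u = lab e ω' u := by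
    intro v ω ω' h u hu
    funext j
    simp only [lab]
    rw [h _ (mem_image_of_mem _ hu)]
  have hD : ∀ v, (univ.filter (fun w => ¬ Disjoint (S w) (S v))).card ≤ 2 * (d + 1) ^ 2 := by
    intro v
    have hs : univ.filter (fun w => ¬ Disjoint (S w) (S v)) ⊆
        (S v).biUnion (fun i => (univ.filter (fun u => (e u).1 = i)).biUnion (fun x => insert x (N x))) := by
      intro w hw
      have hw' := (mem_filter.1 hw).2
      rw [Finset.not_disjoint_iff] at hw'
      obtain ⟨i, hi1, hi2⟩ := hw'
      obtain ⟨x, hx, hxi⟩ := mem_image.1 hi1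
      refine mem_biUnion.2 ⟨i, hi2, mem_biUnion.2 ⟨x, mem_filter.2 ⟨mem_univ _, hxi⟩, ?_⟩⟩
      rcases mem_insert.1 hx with h | h
      · rw [h]; exact mem_insert_self _ _
      · apply mem_insert_of_mem
        simp only [N, mem_filter, mem_univ, true_and] at h ⊢
        exact h.symm
    have hins : ∀ x, (insert x (N x)).card ≤ d + 1 := fun x =>
      (card_insert_le _ _).trans (by simp only [N]; rw [hdeg x])
    refine (card_le_card hs).trans ?_
    have h1 := Finset.card_biUnion_le_card_mul (S v) (fun i => (univ.filter (fun u => (e u).1 = i)).biUnion (fun x => insert x (N x))) (2 * (d + 1)) (by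
      intro i _
      refine (Finset.card_biUnion_le_card_mul _ _ (d + 1) (fun x _ => hins x)).trans ?_
      exact Nat.mul_le_mul_right _ (pair_card e i))
    have h2 : (S v).card ≤ d + 1 := card_image_le.trans (hins v)
    calc _ ≤ _ := h1
      _ ≤ (d + 1) * (2 * (d + 1)) := Nat.mul_le_mul_right _ h2
      _ = _ := by ring
  have hbig : (1 : ℝ) ≤ 2 * (d + 1) ^ 2 := by
    have : (0 : ℝ) ≤ d := by positivity
    nlinarith
  obtain ⟨ω, hω⟩ := lll B S (by
      intro v ω ω' h hb
      have hl := hlab v ω ω' h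
      rcases mem_union.1 hb with hb | hb
      · obtain ⟨j, _, hj⟩ := mem_biUnion.1 hb
        refine mem_union_left _ (mem_biUnion.2 ⟨j, mem_univ _, ?_⟩)
        simp only [B1, mem_filter, mem_univ, true_and] at hj ⊢
        have : (univ.filter (fun u => G.Adj v u ∧ dl e ω' v u ∈ Q j)) = (univ.filter (fun u => G.Adj v u ∧ dl e ω v u ∈ Q j)) := by
          apply Finset.filter_congr
          intro u _
          apply and_congr_right
          intro hu
          have : dl e ω' v u = dl e ω v u := by
            funext x
            simp only [dl]
            rw [hl v (mem_insert_self _ _), hl u (mem_insert_of_mem (by simp [N, hu]))]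
          rw [this]
        rw [this]; exact hj
      · obtain ⟨u, hu, hj⟩ := mem_biUnion.1 hb
        refine mem_union_right _ (mem_biUnion.2 ⟨u, hu, ?_⟩)
        simp only [B2, mem_filter, mem_univ, true_and] at hj ⊢
        rw [← hl u (mem_insert_of_mem hu), ← hl v (mem_insert_self _ _)]; exact hj)
    p hp0 (by nlinarith) (by
      intro v
      have h1 : (B v).card ≤ ∑ j, (B1 v j).card + ∑ u ∈ N v, (B2 v u).card :=
        (card_union_le _ _).trans (Nat.add_le_add card_biUnion_le card_biUnion_le)
      have h2 : ((B v).card : ℝ) ≤ ∑ j, ((B1 v j).card : ℝ) + ∑ u ∈ N v, ((B2 v u).card : ℝ) := by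
        exact_mod_cast h1
      have h3 : ∑ j, ((B1 v j).card : ℝ) ≤ Fintype.card J * (2 * Real.exp (-((E - 1) ^ 2 / (4 * d))) * Fintype.card (ι → (Fin M → Bool))) := by
        have := Finset.sum_le_card_nsmul univ (fun j => ((B1 v j).card : ℝ)) _ (fun j _ => conc e G d hd v (hdeg v) (Q j) E hE)
        simpa using this
      have h4 : ∑ u ∈ N v, ((B2 v u).card : ℝ) ≤ d * (1 / 2 ^ M * Fintype.card (ι → (Fin M → Bool))) := by
        have := Finset.sum_le_card_nsmul (N v) (fun u => ((B2 v u).card : ℝ)) _ (fun u hu => mono_count hM e u v (by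
          simp only [N, mem_filter, mem_univ, true_and] at hu
          exact hu.ne'))
        rw [show (N v).card = d from hdeg v] at this
        simpa using this
      rw [hp]
      linarith)
    (2 * (d + 1) ^ 2) hD (by push_cast; exact hnum)
  refine ⟨ω, ?_, ?_⟩
  · intro v u huv heq
    apply hω v
    refine mem_union_right _ (mem_biUnion.2 ⟨u, by simp [N, huv], ?_⟩)
    simp [B2, heq]
  · intro v j
    by_contra hc
    apply hω v
    refine mem_union_left _ (mem_biUnion.2 ⟨j, mem_univ _, ?_⟩)
    simp only [B1, mem_filter, mem_univ, true_and]
    exact not_lt.1 hc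

lemma factor {V : Type*} [Fintype V] (U W : Finset V) (R : V → V → Prop) (f g : V → ℕ)
    (hsum : ∑ x ∈ U, f x = ∑ y ∈ W, g y)
    (hall : ∀ S ⊆ U, ∀ T ⊆ W, ∑ x ∈ S, f x ≤ ∑ y ∈ T, g y + ∑ x ∈ S, ((W \ T).filter (R x)).card) :
    ∃ C : V → V → Prop, (∀ x y, C x y → x ∈ U ∧ y ∈ W ∧ R x y) ∧
      (∀ x ∈ U, (univ.filter (fun y => C x y)).card = f x) ∧
      (∀ y ∈ W, (univ.filter (fun x => C x y)).card = g y) := by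
  let Ed : Finset (V × V) := (U ×ˢ W).filter (fun p => R p.1 p.2)
  let deg : V → ℕ := fun x => (W.filter (R x)).card
  let cap : V ⊕ V → ℕ := fun z => Sum.elim (fun x => deg x - f x) g z
  have hfd : ∀ x ∈ U, f x ≤ deg x := by
    intro x hx
    have := hall {x} (by simpa using hx) ∅ (by simp)
    simpa using this
  let t : Ed → Finset (Σ _ : V ⊕ V, ℕ) := fun p =>
    ({Sum.inl p.1.1, Sum.inr p.1.2} : Finset (V ⊕ V)).sigma (fun z => range (cap z))
  have hallcond : ∀ s : Finset Ed, s.card ≤ (s.biUnion t).card := by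
    intro s
    let S := s.image (fun p => p.1.1)
    let T := s.image (fun p => p.1.2)
    have hS : S ⊆ U := by
      intro x hx
      obtain ⟨p, _, rfl⟩ := mem_image.1 hx
      exact (mem_product.1 (mem_filter.1 p.2).1).1
    have hT : T ⊆ W := by
      intro x hx
      obtain ⟨p, _, rfl⟩ := mem_image.1 hx
      exact (mem_product.1 (mem_filter.1 p.2).1).2
    have h1 : (S.disjSum T).sigma (fun z => range (cap z)) ⊆ s.biUnion t := by
      rintro ⟨z, k⟩ hz
      obtain ⟨hz1, hz2⟩ := mem_sigma.1 hz
      rcases z with x | y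
      · obtain ⟨p, hp, hpx⟩ := mem_image.1 (Finset.inl_mem_disjSum.1 hz1)
        refine mem_biUnion.2 ⟨p, hp, mem_sigma.2 ⟨?_, hz2⟩⟩
        simp [hpx]
      · obtain ⟨p, hp, hpx⟩ := mem_image.1 (Finset.inr_mem_disjSum.1 hz1)
        refine mem_biUnion.2 ⟨p, hp, mem_sigma.2 ⟨?_, hz2⟩⟩
        simp [hpx]
    refine le_trans ?_ (card_le_card h1)
    rw [card_sigma, Finset.sum_disjSum]
    simp only [card_range, cap, Sum.elim_inl, Sum.elim_inr]
    have h2 : s.card ≤ ∑ x ∈ S, (T.filter (R x)).card := by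
      rw [← Finset.card_sigma S (fun x => T.filter (R x))]
      refine Finset.card_le_card_of_injOn (fun p => ⟨p.1.1, p.1.2⟩) ?_ ?_
      · intro p hp
        have hp' : p ∈ s := hp
        refine mem_coe.2 (mem_sigma.2 ⟨mem_image_of_mem _ hp', mem_filter.2 ⟨mem_image_of_mem _ hp', ?_⟩⟩)
        exact (mem_filter.1 p.2).2
      · intro p _ q _ h
        simp only [Sigma.mk.injEq, heq_eq_eq] at h
        exact Subtype.ext (Prod.ext h.1 h.2)
    have h3 : ∀ x, deg x = (T.filter (R x)).card + ((W \ T).filter (R x)).card := by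
      intro x
      simp only [deg]
      rw [← card_union_of_disjoint, ← filter_union, Finset.union_sdiff_of_subset hT]
      exact disjoint_filter_filter disjoint_sdiff
    have h4 := hall S hS T hT
    have h5 : ∑ x ∈ S, (deg x - f x) + ∑ x ∈ S, f x = ∑ x ∈ S, (T.filter (R x)).card + ∑ x ∈ S, ((W \ T).filter (R x)).card := by
      rw [← sum_add_distrib, ← sum_add_distrib]
      apply sum_congr rfl
      intro x hx
      rw [← h3]
      have := hfd x (hS hx)
      omega
    omega
  obtain ⟨m, minj, hm⟩ := (Finset.all_card_le_biUnion_card_iff_exists_injective t).1 hallcond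
  let All := (U.disjSum W).sigma (fun z => range (cap z))
  have himg : univ.image m = All := by
    apply Finset.eq_of_subset_of_card_le
    · intro z hz
      obtain ⟨p, _, rfl⟩ := mem_image.1 hz
      have h1 := mem_sigma.1 (hm p)
      refine mem_sigma.2 ⟨?_, h1.2⟩
      have hp := mem_product.1 (mem_filter.1 p.2).1
      have h2 := h1.1
      simp only [mem_insert, mem_singleton] at h2
      rcases h2 with h | h <;> rw [h] <;> simp [hp.1, hp.2]
    · rw [card_image_of_injective _ minj, card_univ, Fintype.card_coe, card_sigma, Finset.sum_disjSum]
      simp only [card_range, cap, Sum.elim_inl, Sum.elim_inr]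
      have : Ed.card = ∑ x ∈ U, deg x := by
        rw [← Finset.card_sigma U (fun x => W.filter (R x))]
        refine Finset.card_bij' (fun p _ => ⟨p.1, p.2⟩) (fun p _ => (p.1, p.2)) ?_ ?_ ?_ ?_
        · intro p hp
          simp only [Ed, mem_filter, mem_product] at hp
          simp only [mem_sigma, mem_filter]; tauto
        · intro p hp
          simp only [mem_sigma, mem_filter] at hp
          simp only [Ed, mem_filter, mem_product]; tauto
        · intro p _; rfl
        · intro p _; rfl
      rw [this, ← hsum, ← sum_add_distrib]
      apply le_of_eq
      apply sum_congr rfl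
      intro x hx
      have := hfd x hx
      omega
  have fib : ∀ z ∈ U.disjSum W, (univ.filter (fun p : Ed => (m p).1 = z)).card = cap z := by
    intro z hz
    have : (univ.filter (fun p : Ed => (m p).1 = z)).image m = ({z} : Finset (V ⊕ V)).sigma (fun z => range (cap z)) := by
      ext ⟨w, k⟩
      simp only [mem_image, mem_filter, mem_univ, true_and, mem_sigma, mem_singleton, mem_range]
      constructor
      · rintro ⟨p, hp, hpw⟩
        have h1 : m p ∈ All := by rw [← himg]; exact mem_image_of_mem _ (mem_univ _)
        rw [hpw] at h1 hp
        refine ⟨hp, ?_⟩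
        simpa using (mem_sigma.1 h1).2
      · rintro ⟨rfl, hk⟩
        have : (⟨w, k⟩ : Σ _ : V ⊕ V, ℕ) ∈ All := mem_sigma.2 ⟨hz, by simpa using hk⟩
        rw [← himg] at this
        obtain ⟨p, _, hp⟩ := mem_image.1 this
        exact ⟨p, by rw [hp], hp⟩
    rw [← card_image_of_injective _ minj, this, card_sigma]
    simp
  obtain ⟨C, hCd⟩ : ∃ C : V → V → Prop, ∀ x y, C x y ↔ ∃ h : (x, y) ∈ Ed, (m ⟨(x, y), h⟩).1 = Sum.inr y :=
    ⟨_, fun _ _ => Iff.rfl⟩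
  refine ⟨C, ?_, ?_, ?_⟩
  · intro x y hxy
    obtain ⟨h, _⟩ := (hCd x y).1 hxy
    have h1 := mem_filter.1 h
    have h2 := mem_product.1 h1.1
    exact ⟨h2.1, h2.2, h1.2⟩
  · intro x hx
    have h1 := fib (Sum.inl x) (by simp [hx])
    simp only [cap, Sum.elim_inl] at h1
    have h2 : (univ.filter (fun p : Ed => (m p).1 = Sum.inl x)).card =
        (univ.filter (fun y => ∃ h : (x, y) ∈ Ed, (m ⟨(x, y), h⟩).1 = Sum.inl x)).card := by
      refine Finset.card_bij (fun p _ => p.1.2) ?_ ?_ ?_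
      · intro p hp
        have hp' := (mem_filter.1 hp).2
        have h1 := (mem_sigma.1 (hm p)).1
        rw [hp'] at h1
        simp at h1
        simp only [mem_filter, mem_univ, true_and]
        subst h1
        exact ⟨p.2, hp'⟩
      · intro p hp q hq hpq
        have hp' := (mem_filter.1 hp).2
        have h1 := (mem_sigma.1 (hm p)).1
        rw [hp'] at h1
        simp at h1
        have hq' := (mem_filter.1 hq).2
        have h2 := (mem_sigma.1 (hm q)).1
        rw [hq'] at h2
        simp at h2
        exact Subtype.ext (Prod.ext (h1.symm.trans h2) hpq)
      · intro y hy
        obtain ⟨h, hh⟩ := (mem_filter.1 hy).2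
        exact ⟨⟨(x, y), h⟩, by simp [hh], rfl⟩
    have h3 : deg x = (univ.filter (fun y => ∃ h : (x, y) ∈ Ed, (m ⟨(x, y), h⟩).1 = Sum.inl x)).card
        + (univ.filter (fun y => C x y)).card := by
      simp only [deg]
      rw [← card_union_of_disjoint]
      · congr 1
        ext y
        simp only [mem_filter, mem_univ, true_and, mem_union, hCd]
        constructor
        · intro hy
          have he : (x, y) ∈ Ed := mem_filter.2 ⟨mem_product.2 ⟨hx, hy.1⟩, hy.2⟩
          have h1 := (mem_sigma.1 (hm ⟨(x, y), he⟩)).1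
          simp only [mem_insert, mem_singleton] at h1
          rcases h1 with h | h
          · left; exact ⟨he, h⟩
          · right; exact ⟨he, h⟩
        · rintro (⟨h, _⟩ | ⟨h, _⟩)
          · have h1 := mem_filter.1 h
            exact ⟨(mem_product.1 h1.1).2, h1.2⟩
          · have h1 := mem_filter.1 h
            exact ⟨(mem_product.1 h1.1).2, h1.2⟩
      · rw [disjoint_left]
        intro y h1 h2
        obtain ⟨h, ha⟩ := (mem_filter.1 h1).2
        obtain ⟨h', hb⟩ := (hCd _ _).1 (mem_filter.1 h2).2
        rw [ha] at hb
        cases hb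
    have := hfd x hx
    omega
  · intro y hy
    have h1 := fib (Sum.inr y) (by simp [hy])
    simp only [cap, Sum.elim_inr] at h1
    rw [← h1]
    symm
    refine Finset.card_bij (fun p _ => p.1.1) ?_ ?_ ?_
    · intro p hp
      have hp' := (mem_filter.1 hp).2
      have h1 := (mem_sigma.1 (hm p)).1
      rw [hp'] at h1
      simp at h1
      simp only [mem_filter, mem_univ, true_and, hCd]
      subst h1
      exact ⟨p.2, hp'⟩
    · intro p hp q hq hpq
      have hp' := (mem_filter.1 hp).2
      have h1 := (mem_sigma.1 (hm p)).1
      rw [hp'] at h1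
      simp at h1
      have hq' := (mem_filter.1 hq).2
      have h2 := (mem_sigma.1 (hm q)).1
      rw [hq'] at h2
      simp at h2
      exact Subtype.ext (Prod.ext hpq (h1.symm.trans h2))
    · intro x hx
      obtain ⟨h, hh⟩ := (hCd _ _).1 (mem_filter.1 hx).2
      exact ⟨⟨(x, y), h⟩, by simp [hh], rfl⟩

/-- degree -/
noncomputable def dg {V : Type*} [Fintype V] (G : SimpleGraph V) (v : V) : ℕ := (univ.filter (G.Adj v)).card

/-- one-factorization, as an edge colouring -/
def Fac {V : Type*} (G : SimpleGraph V) (d : ℕ) : Prop :=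
  ∃ c : V → V → ℕ, (∀ u v, c u v = c v u) ∧ (∀ u v, G.Adj u v → c u v < d) ∧
    ∀ v, ∀ i < d, ∃! u, G.Adj v u ∧ c v u = i

lemma Fac.dg {V : Type*} [Fintype V] {G : SimpleGraph V} {d : ℕ} (h : Fac G d) (v : V) : dg G v = d := by
  obtain ⟨c, -, h1, h2⟩ := h
  rw [← Finset.card_range d]
  refine Finset.card_bij (fun u _ => c v u) ?_ ?_ ?_
  · intro u hu
    exact mem_range.2 (h1 v u (mem_filter.1 hu).2)
  · intro a ha b hb hab
    have ha' := (mem_filter.1 ha).2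
    have hb' := (mem_filter.1 hb).2
    obtain ⟨u, _, hu⟩ := h2 v _ (h1 v a ha')
    rw [hu a ⟨ha', rfl⟩, hu b ⟨hb', hab.symm⟩]
  · intro i hi
    obtain ⟨u, hu, _⟩ := h2 v i (mem_range.1 hi)
    exact ⟨u, by simp [hu.1], hu.2⟩

lemma Fac.add {V : Type*} {H K : SimpleGraph V} {a b : ℕ} (hHK : ∀ u v, H.Adj u v → ¬ K.Adj u v)
    (hH : Fac H a) (hK : Fac K b) : Fac (H ⊔ K) (a + b) := by
  obtain ⟨c, c0, c1, c2⟩ := hH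
  obtain ⟨k, k0, k1, k2⟩ := hK
  refine ⟨fun u v => if H.Adj u v then c u v else a + k u v, ?_, ?_, ?_⟩
  · intro u v
    simp only [H.adj_comm u v, c0 u v, k0 u v]
  · intro u v h
    by_cases hh : H.Adj u v
    · simp only [hh, if_true]; have := c1 u v hh; omega
    · have hk : K.Adj u v := by
        rcases h with h | h
        · exact absurd h hh
        · exact h
      simp only [hh, if_false]; have := k1 u v hk; omega
  · intro v i hi
    by_cases hia : i < a
    · obtain ⟨u, hu, huu⟩ := c2 v i hia
      refine ⟨u, ⟨Or.inl hu.1, by simp [hu.1, hu.2]⟩, ?_⟩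
      rintro y ⟨hy1, hy2⟩
      by_cases hh : H.Adj v y
      · simp only [hh, if_true] at hy2
        exact huu y ⟨hh, hy2⟩
      · simp only [hh, if_false] at hy2
        omega
    · obtain ⟨u, hu, huu⟩ := k2 v (i - a) (by omega)
      have hnh : ¬ H.Adj v u := fun h => hHK _ _ h hu.1
      refine ⟨u, ⟨Or.inr hu.1, by simp only [hnh, if_false]; have := hu.2; omega⟩, ?_⟩
      rintro y ⟨hy1, hy2⟩
      by_cases hh : H.Adj v y
      · simp only [hh, if_true] at hy2
        have := c1 v y hh
        omega
      · have hk : K.Adj v y := by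
          rcases hy1 with h | h
          · exact absurd h hh
          · exact h
        simp only [hh, if_false] at hy2
        exact huu y ⟨hk, by omega⟩

lemma dg_sup {V : Type*} [Fintype V] {H K : SimpleGraph V} (hHK : ∀ u v, H.Adj u v → ¬ K.Adj u v) (v : V) :
    dg (H ⊔ K) v = dg H v + dg K v := by
  unfold dg
  rw [← card_union_of_disjoint]
  · congr 1
    ext u
    simp
  · rw [disjoint_left]
    intro u h1 h2
    exact hHK _ _ (mem_filter.1 h1).2 (mem_filter.1 h2).2

lemma dg_sdiff {V : Type*} [Fintype V] {H K : SimpleGraph V} (h : K ≤ H) (v : V) :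
    dg (H \ K) v + dg K v = dg H v := by
  rw [← dg_sup (by intro u v h; exact h.2)]
  congr 1
  exact sdiff_sup_cancel h

/-- the graph of a bipartite relation -/
def relG {V : Type*} (C : V → V → Prop) (s : V → Bool) (h : ∀ x y, C x y → s x ≠ s y) : SimpleGraph V where
  Adj u v := C u v ∨ C v u
  symm := ⟨by intro u v huv; exact huv.symm⟩
  loopless := ⟨by rintro u (h' | h') <;> exact h _ _ h' rfl⟩

lemma konig {V : Type*} [Fintype V] (r : ℕ) : ∀ (H : SimpleGraph V) (s : V → Bool)
    (_ : ∀ u v, H.Adj u v → s u ≠ s v) (_ : ∀ v, dg H v = r), Fac H r := by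
  induction r with
  | zero =>
    intro H s hs hr
    have hno : ∀ u v, ¬ H.Adj u v := by
      intro u v h
      have := hr u
      unfold dg at this
      rw [Finset.card_eq_zero, Finset.filter_eq_empty_iff] at this
      exact this (mem_univ v) h
    exact ⟨fun _ _ => 0, fun _ _ => rfl, fun u v h => absurd h (hno u v), fun v i hi => absurd hi (by omega)⟩
  | succ r ih =>
    intro H s hs hr
    let U := univ.filter (fun v => s v = true)
    let W := univ.filter (fun v => s v = false)
    have degU : ∀ x ∈ U, (W.filter (H.Adj x)).card = r + 1 := by
      intro x hx
      rw [← hr x, dg]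
      congr 1
      ext y
      simp only [W, mem_filter, mem_univ, true_and]
      constructor
      · exact fun h => h.2
      · intro h
        refine ⟨?_, h⟩
        have h1 := hs x y h
        have h2 := (mem_filter.1 hx).2
        rw [h2] at h1
        simpa using h1.symm
    have degW : ∀ y ∈ W, (univ.filter (fun x => H.Adj x y)).card = r + 1 := by
      intro y hy
      rw [← hr y, dg]
      congr 1
      ext x
      simp [H.adj_comm]
    have dc : ∀ S T : Finset V, ∑ x ∈ S, (T.filter (H.Adj x)).card = ∑ y ∈ T, (S.filter (fun x => H.Adj x y)).card := by
      intro S T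
      exact Finset.sum_card_bipartiteAbove_eq_sum_card_bipartiteBelow H.Adj
    have hdouble : ∀ S ⊆ U, ∀ T ⊆ W, (r + 1) * S.card ≤ (r + 1) * T.card + ∑ x ∈ S, ((W \ T).filter (H.Adj x)).card := by
      intro S hS T hT
      have h1 : ∑ x ∈ S, (W.filter (H.Adj x)).card = (r + 1) * S.card := by
        rw [Finset.sum_congr rfl (fun x hx => degU x (hS hx))]
        simp [mul_comm]
      have h2 : ∑ x ∈ S, (W.filter (H.Adj x)).card = ∑ x ∈ S, (T.filter (H.Adj x)).card + ∑ x ∈ S, ((W \ T).filter (H.Adj x)).card := by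
        rw [← sum_add_distrib]
        apply sum_congr rfl
        intro x _
        rw [← card_union_of_disjoint, ← filter_union, Finset.union_sdiff_of_subset hT]
        exact disjoint_filter_filter disjoint_sdiff
      have h3 : ∑ x ∈ S, (T.filter (H.Adj x)).card ≤ (r + 1) * T.card := by
        rw [dc]
        have := Finset.sum_le_card_nsmul T (fun y => (S.filter (fun x => H.Adj x y)).card) (r + 1) (fun y hy => by
          rw [← degW y (hT hy)]
          exact card_le_card (filter_subset_filter _ (subset_univ _)))
        simpa [mul_comm] using this
      omega
    have hUW : U.card = W.card := by
      have h1 : ∑ x ∈ U, (W.filter (H.Adj x)).card = U.card * (r + 1) := by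
        rw [Finset.sum_congr rfl degU]; simp
      have h2 : ∑ y ∈ W, (U.filter (fun x => H.Adj x y)).card = W.card * (r + 1) := by
        rw [Finset.sum_congr rfl (g := fun _ => r + 1)]
        · simp
        · intro y hy
          rw [← degW y hy]
          congr 1
          ext x
          simp only [U, mem_filter, mem_univ, true_and]
          constructor
          · exact fun h => h.2
          · intro h
            refine ⟨?_, h⟩
            have h1 := hs x y h
            have h2 := (mem_filter.1 hy).2
            rw [h2] at h1
            simpa using h1
      rw [dc, h2] at h1
      exact (Nat.eq_of_mul_eq_mul_right (by omega) h1).symm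
    obtain ⟨C, hC, hCU, hCW⟩ := factor U W H.Adj (fun _ => 1) (fun _ => 1) (by simpa using hUW) (by
      intro S hS T hT
      have h := hdouble S hS T hT
      simp only [sum_const, smul_eq_mul, mul_one]
      have h2 : (r + 1) * S.card ≤ (r + 1) * (T.card + ∑ x ∈ S, ((W \ T).filter (H.Adj x)).card) := by
        nlinarith [Nat.zero_le (∑ x ∈ S, ((W \ T).filter (H.Adj x)).card), Nat.zero_le r]
      exact Nat.le_of_mul_le_mul_left h2 (by omega))
    let K := relG C s (fun x y h => hs x y (hC x y h).2.2)
    have hKH : K ≤ H := by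
      rintro u v (h | h)
      · exact (hC _ _ h).2.2
      · exact (hC _ _ h).2.2.symm
    have hK1 : ∀ v, dg K v = 1 := by
      intro v
      unfold dg
      cases hv : s v
      · rw [← hCW v (by simp [W, hv])]
        congr 1
        apply filter_congr
        intro u _
        constructor
        · rintro (h | h)
          · have := (mem_filter.1 (hC _ _ h).1).2
            rw [hv] at this; cases this
          · exact h
        · exact fun h => Or.inr h
      · rw [← hCU v (by simp [U, hv])]
        congr 1
        apply filter_congr
        intro u _
        constructor
        · rintro (h | h)
          · exact h
          · have := (mem_filter.1 (hC _ _ h).2.1).2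
            rw [hv] at this; cases this
        · exact fun h => Or.inl h
    have hF1 : Fac K 1 := by
      refine ⟨fun _ _ => 0, fun _ _ => rfl, fun _ _ _ => Nat.one_pos, ?_⟩
      intro v i hi
      have := hK1 v
      unfold dg at this
      obtain ⟨u, hu⟩ := Finset.card_eq_one.1 this
      refine ⟨u, ⟨?_, by simp only; omega⟩, ?_⟩
      · have : u ∈ univ.filter (K.Adj v) := by rw [hu]; simp
        exact (mem_filter.1 this).2
      · rintro y ⟨hy, _⟩
        have : y ∈ univ.filter (K.Adj v) := by simp [hy]
        rw [hu] at this
        simpa using this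
    have hF2 : Fac (H \ K) r := by
      apply ih (H \ K) s (fun u v h => hs u v h.1)
      intro v
      have h1 := dg_sdiff hKH v
      have h2 := hK1 v
      have h3 := hr v
      omega
    have := Fac.add (H := H \ K) (K := K) (fun u v h => h.2) hF2 hF1
    rwa [sdiff_sup_cancel hKH] at this

open Matrix in
lemma mixing {n : ℕ} (G : SimpleGraph (Fin n)) (d : ℕ) (hd : 1 ≤ d) (hreg : ∀ v, dg G v = d)
    (hA : (SimpleGraph.adjMatrix ℝ G).IsHermitian) (i₀ : Fin n) (hi₀ : hA.eigenvalues i₀ = d)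
    (hl : ∀ i, i ≠ i₀ → |hA.eigenvalues i| ≤ (d : ℝ) / 12) (S T : Finset (Fin n)) :
    |((∑ x ∈ S, (T.filter (G.Adj x)).card : ℕ) : ℝ) - d * S.card * T.card / n| ≤ (d : ℝ) / 24 * (S.card + T.card) := by
  set A := SimpleGraph.adjMatrix ℝ G with hAdef
  set b := hA.eigenvectorBasis with hb
  set l := hA.eigenvalues with hldef
  let u : Fin n → Fin n → ℝ := fun i => ⇑(b i)
  have par : ∀ x y : Fin n → ℝ, x ⬝ᵥ y = ∑ i, (u i ⬝ᵥ x) * (u i ⬝ᵥ y) := by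
    intro x y
    have := b.sum_inner_mul_inner (WithLp.toLp 2 x) (WithLp.toLp 2 y)
    simp only [EuclideanSpace.inner_eq_star_dotProduct, star_trivial] at this
    rw [dotProduct_comm x y, ← this]
    refine Finset.sum_congr rfl (fun i _ => ?_)
    rw [dotProduct_comm y]
  have eig : ∀ i (y : Fin n → ℝ), u i ⬝ᵥ (A *ᵥ y) = l i * (u i ⬝ᵥ y) := by
    intro i y
    have h1 : A *ᵥ (u i) = l i • (u i) := hA.mulVec_eigenvectorBasis i
    have h2 : u i ᵥ* A = A *ᵥ u i := by
      rw [← Matrix.mulVec_transpose]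
      congr 1
    rw [Matrix.dotProduct_mulVec, h2, h1, smul_dotProduct, smul_eq_mul]
  let ind : Finset (Fin n) → Fin n → ℝ := fun S v => if v ∈ S then 1 else 0
  have indd : ∀ S T : Finset (Fin n), ind S ⬝ᵥ ind T = ((S ∩ T).card : ℝ) := by
    intro S T
    simp only [ind, dotProduct, ite_mul, one_mul, zero_mul]
    simp
  have hone : A *ᵥ (ind univ) = (d : ℝ) • ind univ := by
    funext v
    simp only [mulVec, dotProduct, ind, mem_univ, if_true, mul_one, Pi.smul_apply, smul_eq_mul, hAdef, SimpleGraph.adjMatrix_apply]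
    rw [← hreg v, dg]
    simp
  have ho : ∀ i, i ≠ i₀ → u i ⬝ᵥ ind univ = 0 := by
    intro i hi
    have h1 := eig i (ind univ)
    rw [hone, dotProduct_smul, smul_eq_mul] at h1
    have h2 := (abs_le.1 (hl i hi)).2
    have h3 : (1 : ℝ) ≤ d := by exact_mod_cast hd
    have h4 : ((d : ℝ) - l i) * (u i ⬝ᵥ ind univ) = 0 := by linarith
    rcases mul_eq_zero.1 h4 with h | h
    · linarith
    · exact h
  have hAe : ind S ⬝ᵥ (A *ᵥ ind T) = ((∑ x ∈ S, (T.filter (G.Adj x)).card : ℕ) : ℝ) := by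
    simp only [dotProduct, ind, mulVec, ite_mul, one_mul, zero_mul, mul_ite, mul_one, mul_zero, hAdef, SimpleGraph.adjMatrix_apply]
    push_cast
    rw [← Finset.sum_filter]
    simp only [Finset.filter_mem_eq_inter, univ_inter]
    refine Finset.sum_congr rfl (fun x _ => ?_)
    rw [← Finset.sum_filter]
    simp only [Finset.filter_mem_eq_inter, univ_inter]
    simp
  have s1 : ∀ S : Finset (Fin n), (S.card : ℝ) = (u i₀ ⬝ᵥ ind S) * (u i₀ ⬝ᵥ ind univ) := by
    intro S
    have h1 := par (ind S) (ind univ)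
    rw [indd, inter_univ] at h1
    rw [h1]
    apply Finset.sum_eq_single
    · intro i _ hi
      rw [ho i hi, mul_zero]
    · simp
  have hn := s1 univ
  rw [card_univ, Fintype.card_fin] at hn
  have hnpos : (0 : ℝ) < n := by exact_mod_cast i₀.pos
  have e1 : (d : ℝ) * S.card * T.card / n = l i₀ * ((u i₀ ⬝ᵥ ind S) * (u i₀ ⬝ᵥ ind T)) := by
    rw [div_eq_iff hnpos.ne', hi₀, s1 S, s1 T, hn]
    ring
  have e2 : ((∑ x ∈ S, (T.filter (G.Adj x)).card : ℕ) : ℝ) = ∑ i, l i * ((u i ⬝ᵥ ind S) * (u i ⬝ᵥ ind T)) := by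
    rw [← hAe, par]
    refine Finset.sum_congr rfl (fun i _ => ?_)
    rw [eig]; ring
  rw [e1, e2, ← Finset.add_sum_erase univ _ (mem_univ i₀), add_sub_cancel_left]
  have e3 : ∀ S : Finset (Fin n), ∑ i ∈ univ.erase i₀, (u i ⬝ᵥ ind S) ^ 2 ≤ S.card := by
    intro S
    have h1 := par (ind S) (ind S)
    rw [indd, inter_self] at h1
    rw [h1]
    refine (Finset.sum_le_sum_of_subset_of_nonneg (erase_subset _ _) (fun _ _ _ => sq_nonneg _)).trans (le_of_eq ?_)
    refine Finset.sum_congr rfl (fun i _ => sq _)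
  calc _ ≤ ∑ i ∈ univ.erase i₀, |l i * ((u i ⬝ᵥ ind S) * (u i ⬝ᵥ ind T))| := abs_sum_le_sum_abs _ _
    _ ≤ ∑ i ∈ univ.erase i₀, (d : ℝ) / 24 * ((u i ⬝ᵥ ind S) ^ 2 + (u i ⬝ᵥ ind T) ^ 2) := by
        apply Finset.sum_le_sum
        intro i hi
        have hli := hl i (ne_of_mem_erase hi)
        rw [abs_mul]
        have h1 : |(u i ⬝ᵥ ind S) * (u i ⬝ᵥ ind T)| ≤ ((u i ⬝ᵥ ind S) ^ 2 + (u i ⬝ᵥ ind T) ^ 2) / 2 := by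
          rw [abs_le]; constructor
          · nlinarith [sq_nonneg ((u i ⬝ᵥ ind S) + (u i ⬝ᵥ ind T))]
          · nlinarith [sq_nonneg ((u i ⬝ᵥ ind S) - (u i ⬝ᵥ ind T))]
        calc _ ≤ (d : ℝ) / 12 * (((u i ⬝ᵥ ind S) ^ 2 + (u i ⬝ᵥ ind T) ^ 2) / 2) :=
              mul_le_mul hli h1 (abs_nonneg _) (by positivity)
          _ = _ := by ring
    _ = (d : ℝ) / 24 * (∑ i ∈ univ.erase i₀, (u i ⬝ᵥ ind S) ^ 2 + ∑ i ∈ univ.erase i₀, (u i ⬝ᵥ ind T) ^ 2) := by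
        rw [← Finset.mul_sum, Finset.sum_add_distrib]
    _ ≤ _ := mul_le_mul_of_nonneg_left (add_le_add (e3 S) (e3 T)) (by positivity)

noncomputable def ec {V : Type*} (H : SimpleGraph V) (S T : Finset V) : ℕ := ∑ x ∈ S, (T.filter (H.Adj x)).card

lemma ec_comm {V : Type*} (H : SimpleGraph V) (S T : Finset V) : ec H S T = ec H T S := by
  unfold ec
  have h : ∑ x ∈ S, (T.filter (H.Adj x)).card = ∑ y ∈ T, (S.filter (fun x => H.Adj x y)).card :=
    Finset.sum_card_bipartiteAbove_eq_sum_card_bipartiteBelow H.Adj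
  rw [h]
  refine sum_congr rfl (fun y _ => ?_)
  congr 1
  apply filter_congr
  intro x _
  rw [H.adj_comm]

lemma ec_split {V : Type*} (H : SimpleGraph V) (S T W : Finset V) (h : T ⊆ W) :
    ec H S W = ec H S T + ec H S (W \ T) := by
  unfold ec
  rw [← sum_add_distrib]
  refine sum_congr rfl (fun y _ => ?_)
  rw [← card_union_of_disjoint, ← filter_union, Finset.union_sdiff_of_subset h]
  exact disjoint_filter_filter disjoint_sdiff

lemma ec_le {V : Type*} (H : SimpleGraph V) (S T W : Finset V) (h : T ⊆ W) (R : ℝ)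
    (hR : ∀ x ∈ S, ((W.filter (H.Adj x)).card : ℝ) ≤ R) : (ec H S T : ℝ) ≤ R * S.card := by
  unfold ec
  push_cast
  have := Finset.sum_le_card_nsmul S (fun x => ((T.filter (H.Adj x)).card : ℝ)) R (fun x hx =>
    (Nat.cast_le.2 (card_le_card (filter_subset_filter _ h))).trans (hR x hx))
  simpa [mul_comm] using this

lemma le_ec {V : Type*} (H : SimpleGraph V) (S W : Finset V) (R : ℝ)
    (hR : ∀ x ∈ S, R ≤ ((W.filter (H.Adj x)).card : ℝ)) : R * S.card ≤ (ec H S W : ℝ) := by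
  unfold ec
  push_cast
  have := Finset.card_nsmul_le_sum S (fun x => ((W.filter (H.Adj x)).card : ℝ)) R (fun x hx => hR x hx)
  simpa [mul_comm] using this

/-- Mixing property -/
def Mix {V : Type*} [Fintype V] (G : SimpleGraph V) (d : ℕ) : Prop :=
  ∀ S T : Finset V, |(ec G S T : ℝ) - d * S.card * T.card / Fintype.card V| ≤ (d : ℝ) / 24 * (S.card + T.card)

/-- one-sided case of the Hall condition -/
lemma hall_case1 {V : Type*} [Fintype V] (G D : SimpleGraph V) (d : ℕ) (hmix : Mix G d)
    (U W : Finset V) (a : ℝ) (hn : (0 : ℝ) < Fintype.card V) (ha : a ≤ 0.251 * Fintype.card V)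
    (Rm F1 : ℝ) (hRm : Rm + F1 ≤ d / 100)
    (hG : ∀ x ∈ U, (0.249 : ℝ) * d ≤ ((W.filter (G.Adj x)).card : ℝ))
    (hD : ∀ x ∈ U, ((W.filter (D.Adj x)).card : ℝ) ≤ Rm)
    (S T : Finset V) (hS : S ⊆ U) (hT : T ⊆ W) (hsa : 2 * (S.card : ℝ) ≤ a) (hts : 10 * (T.card : ℝ) ≤ 11 * S.card) :
    F1 * S.card + ec D S (W \ T) ≤ ec G S (W \ T) := by
  have h1 := le_ec G S W _ (fun x hx => hG x (hS hx))
  have h2 := ec_le D S (W \ T) W sdiff_subset Rm (fun x hx => hD x (hS hx))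
  have h3 := (abs_le.1 (hmix S T)).2
  have h4 : (ec G S W : ℝ) = ec G S T + ec G S (W \ T) := by exact_mod_cast ec_split G S T W hT
  set s : ℝ := ((S.card : ℕ) : ℝ) with hs
  set t : ℝ := ((T.card : ℕ) : ℝ) with ht
  set n : ℝ := ((Fintype.card V : ℕ) : ℝ) with hnn
  have s0 : 0 ≤ s := by positivity
  have t0 : 0 ≤ t := by positivity
  have d0 : (0 : ℝ) ≤ d := by positivity
  have h5 : d * s * t / n ≤ 0.13805 * d * s := by
    rw [div_le_iff₀ hn]
    have h6 : s ≤ 0.1255 * n := by linarith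
    have h7 : s * t ≤ (0.1255 * n) * (1.1 * s) := mul_le_mul h6 (by linarith) t0 (by positivity)
    nlinarith
  have h8 : (d : ℝ) * t ≤ d * (1.1 * s) := mul_le_mul_of_nonneg_left (by linarith) d0
  have h9 : (Rm + F1) * s ≤ d / 100 * s := mul_le_mul_of_nonneg_right hRm s0
  have h10 : 0 ≤ d * s := by positivity
  nlinarith

lemma hall_case3 {V : Type*} [Fintype V] (G D : SimpleGraph V) (d : ℕ) (hmix : Mix G d)
    (U W : Finset V) (a : ℝ) (hn : (0 : ℝ) < Fintype.card V) (ha : 0.249 * Fintype.card V ≤ a)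
    (Rm F1 : ℝ) (hRm : Rm + F1 ≤ d / 100) (hF1 : 0 ≤ F1) (hRm0 : 0 ≤ Rm)
    (hDU : ∀ x ∈ U, ((W.filter (D.Adj x)).card : ℝ) ≤ Rm)
    (hDW : ∀ x ∈ W, ((U.filter (D.Adj x)).card : ℝ) ≤ Rm)
    (S Z : Finset V) (hS : S ⊆ U) (hZ : Z ⊆ W) (hsa : a ≤ 2 * (S.card : ℝ)) (hza : a ≤ 2 * (Z.card : ℝ)) :
    F1 * (S.card + Z.card) / 2 + ec D S Z ≤ ec G S Z := by
  have h1 := ec_le D S Z W hZ Rm (fun x hx => hDU x (hS hx))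
  have h2 := ec_le D Z S U hS Rm (fun x hx => hDW x (hZ hx))
  rw [ec_comm] at h2
  have h3 := (abs_le.1 (hmix S Z)).1
  set s : ℝ := ((S.card : ℕ) : ℝ) with hs
  set z : ℝ := ((Z.card : ℕ) : ℝ) with hz
  set n : ℝ := ((Fintype.card V : ℕ) : ℝ) with hnn
  have s0 : 0.1245 * n ≤ s := by linarith
  have z0 : 0.1245 * n ≤ z := by linarith
  have d0 : (0 : ℝ) ≤ d := by positivity
  have hsz : 0.06225 * (s + z) ≤ s * z / n := by
    rw [le_div_iff₀ hn]
    nlinarith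
  have h5 : d * (0.06225 * (s + z)) ≤ d * (s * z / n) := mul_le_mul_of_nonneg_left hsz d0
  have e5 : d * (s * z / n) = d * s * z / n := by ring
  have h9 : (Rm + F1) * (s + z) ≤ d / 100 * (s + z) := mul_le_mul_of_nonneg_right hRm (by linarith)
  have h10 : 0 ≤ d * (s + z) := mul_nonneg d0 (by linarith)
  nlinarith

lemma hall_factor {V : Type*} [Fintype V] (G D : SimpleGraph V) (d : ℕ) (hmix : Mix G d)
    (U W : Finset V) (hn : (0 : ℝ) < Fintype.card V) (hUW : U.card = W.card)
    (ha1 : (0.249 : ℝ) * Fintype.card V ≤ U.card) (ha2 : (U.card : ℝ) ≤ 0.251 * Fintype.card V)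
    (Rm F0 F1 : ℕ) (hRm : (Rm : ℝ) + F1 ≤ d / 100) (hF : 10 * F1 ≤ 11 * F0)
    (hGU : ∀ x ∈ U, (0.249 : ℝ) * d ≤ ((W.filter (G.Adj x)).card : ℝ))
    (hGW : ∀ x ∈ W, (0.249 : ℝ) * d ≤ ((U.filter (G.Adj x)).card : ℝ))
    (hDU : ∀ x ∈ U, (W.filter (D.Adj x)).card ≤ Rm)
    (hDW : ∀ x ∈ W, (U.filter (D.Adj x)).card ≤ Rm)
    (f : V → ℕ) (hf : ∀ x, F0 ≤ f x ∧ f x ≤ F1) (hsum : ∑ x ∈ U, f x = ∑ x ∈ W, f x) :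
    ∃ C : V → V → Prop, (∀ x y, C x y → x ∈ U ∧ y ∈ W ∧ (G.Adj x y ∧ ¬ D.Adj x y)) ∧
      (∀ x ∈ U, (univ.filter (fun y => C x y)).card = f x) ∧
      (∀ y ∈ W, (univ.filter (fun x => C x y)).card = f y) := by
  obtain ⟨R, hR⟩ : ∃ R : V → V → Prop, ∀ x y, R x y ↔ (G.Adj x y ∧ ¬ D.Adj x y) := ⟨_, fun _ _ => Iff.rfl⟩
  suffices h : ∃ C : V → V → Prop, (∀ x y, C x y → x ∈ U ∧ y ∈ W ∧ R x y) ∧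
      (∀ x ∈ U, (univ.filter (fun y => C x y)).card = f x) ∧
      (∀ y ∈ W, (univ.filter (fun x => C x y)).card = f y) by
    simpa only [hR] using h
  apply factor U W R f f hsum
  intro S hS T hT
  have hDU' : ∀ x ∈ U, ((W.filter (D.Adj x)).card : ℝ) ≤ Rm := fun x hx => by exact_mod_cast hDU x hx
  have hDW' : ∀ x ∈ W, ((U.filter (D.Adj x)).card : ℝ) ≤ Rm := fun x hx => by exact_mod_cast hDW x hx
  have hfu : ∀ S : Finset V, ∑ x ∈ S, f x ≤ F1 * S.card := by
    intro S
    have := Finset.sum_le_card_nsmul S f F1 (fun x _ => (hf x).2)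
    simpa [mul_comm] using this
  have hfl : ∀ S : Finset V, F0 * S.card ≤ ∑ x ∈ S, f x := by
    intro S
    have := Finset.card_nsmul_le_sum S f F0 (fun x _ => (hf x).1)
    simpa [mul_comm] using this
  have ratio : ∀ S T : Finset V, ∑ x ∈ T, f x < ∑ x ∈ S, f x → 10 * (T.card : ℝ) ≤ 11 * S.card := by
    intro S T h
    have h1 := (hfl T).trans_lt (h.trans_le (hfu S))
    have h2 : F0 * (10 * T.card) ≤ F0 * (11 * S.card) := by nlinarith
    have h3 : 0 < F0 := by
      rcases Nat.eq_zero_or_pos F0 with h | h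
      · have : F1 = 0 := by omega
        rw [this] at h1; simp at h1
      · exact h
    exact_mod_cast Nat.le_of_mul_le_mul_left h2 h3
  set Z := W \ T with hZ
  have hZW : Z ⊆ W := sdiff_subset
  have hsub : ec G S Z ≤ ∑ x ∈ S, (Z.filter (R x)).card + ec D S Z := by
    unfold ec
    rw [← sum_add_distrib]
    apply sum_le_sum
    intro x _
    refine le_trans (card_le_card ?_) (card_union_le _ _)
    intro y hy
    simp only [mem_filter, mem_union, hR] at hy ⊢
    tauto
  have hcomp : ∑ x ∈ S, f x + ∑ x ∈ U \ S, f x = ∑ x ∈ T, f x + ∑ x ∈ Z, f x := by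
    rw [add_comm, Finset.sum_sdiff hS, hsum, add_comm, Finset.sum_sdiff hT]
  rcases le_or_gt (∑ x ∈ S, f x) (∑ x ∈ T, f x) with h | h
  · exact h.trans (Nat.le_add_right _ _)
  have aZ := hfu Z
  have aS := hfu S
  rcases le_total (2 * (S.card : ℝ)) U.card with hs | hs
  · have h1 := hall_case1 G D d hmix U W U.card hn ha2 Rm F1 hRm hGU hDU' S T hS hT hs (ratio S T h)
    have h2 : F1 * S.card + ec D S Z ≤ ec G S Z := by exact_mod_cast h1
    omega
  rcases le_total (2 * (Z.card : ℝ)) U.card with hz | hz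
  · have h1 := hall_case1 G D d hmix W U U.card hn ha2 Rm F1 hRm hGW hDW' Z (U \ S) hZW sdiff_subset hz
      (ratio Z (U \ S) (by omega))
    rw [Finset.sdiff_sdiff_eq_self hS, ec_comm, ec_comm G] at h1
    have h2 : F1 * Z.card + ec D S Z ≤ ec G S Z := by exact_mod_cast h1
    omega
  · have h1 := hall_case3 G D d hmix U W U.card hn ha1 Rm F1 hRm (by positivity) (by positivity) hDU' hDW' S Z hS hZW hs hz
    have h2 : F1 * (S.card + Z.card) + 2 * ec D S Z ≤ 2 * ec G S Z := by
      have : (F1 : ℝ) * (S.card + Z.card) + 2 * ec D S Z ≤ 2 * ec G S Z := by linarith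
      exact_mod_cast this
    have h3 : F1 * (S.card + Z.card) = F1 * S.card + F1 * Z.card := by ring
    omega

/-- number of elements satisfying a predicate -/
noncomputable def cnt {V : Type*} [Fintype V] (P : V → Prop) : ℕ := (univ.filter P).card

lemma cnt_mono {V : Type*} [Fintype V] {P Q : V → Prop} (h : ∀ u, P u → Q u) : cnt P ≤ cnt Q :=
  card_le_card (fun u hu => by
    simp only [mem_filter, mem_univ, true_and] at hu ⊢
    exact h u hu)

lemma cnt_congr {V : Type*} [Fintype V] {P Q : V → Prop} (h : ∀ u, P u ↔ Q u) : cnt P = cnt Q :=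
  le_antisymm (cnt_mono fun u => (h u).1) (cnt_mono fun u => (h u).2)

lemma cnt_or_le {V : Type*} [Fintype V] (P Q : V → Prop) : cnt (fun u => P u ∨ Q u) ≤ cnt P + cnt Q := by
  unfold cnt
  refine le_trans (card_le_card ?_) (card_union_le _ _)
  intro u hu
  simpa using hu

lemma cnt_or {V : Type*} [Fintype V] (P Q : V → Prop) (h : ∀ u, P u → ¬ Q u) :
    cnt (fun u => P u ∨ Q u) = cnt P + cnt Q := by
  unfold cnt
  rw [← card_union_of_disjoint]
  · congr 1
    ext u
    simp
  · rw [disjoint_left]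
    intro u h1 h2
    exact h u (mem_filter.1 h1).2 (mem_filter.1 h2).2

lemma card_filter_cnt {V : Type*} [Fintype V] (T : Finset V) (P : V → Prop) :
    (T.filter P).card = cnt (fun u => u ∈ T ∧ P u) := by
  unfold cnt
  congr 1
  ext u
  simp

/-- classes of a pair of bits -/
noncomputable def cl {V : Type*} [Fintype V] (s b : V → Bool) (x y : Bool) : Finset V :=
  univ.filter (fun v => s v = x ∧ b v = y)

lemma mem_cl {V : Type*} [Fintype V] (s b : V → Bool) (x y : Bool) (v : V) : v ∈ cl s b x y ↔ s v = x ∧ b v = y := by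
  simp [cl]

lemma cross_exists {V : Type*} [Fintype V] (G D : SimpleGraph V) (d : ℕ) (hmix : Mix G d)
    (hn : (0 : ℝ) < Fintype.card V) (s b : V → Bool)
    (hcl : ∀ x y, (0.249 : ℝ) * Fintype.card V ≤ (cl s b x y).card ∧ ((cl s b x y).card : ℝ) ≤ 0.251 * Fintype.card V)
    (hcc : ∀ x y, (cl s b x y).card = (cl s b (!x) (!y)).card)
    (Rm F0 F1 : ℕ) (hRm : (Rm : ℝ) + F1 ≤ d / 100) (hF : 10 * F1 ≤ 11 * F0)
    (hG : ∀ v, (0.249 : ℝ) * d ≤ cnt (fun u => G.Adj v u ∧ s u ≠ s v ∧ b u ≠ b v))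
    (hD : ∀ v, cnt (fun u => D.Adj v u ∧ s u ≠ s v) ≤ Rm)
    (f : V → ℕ) (hf : ∀ x, F0 ≤ f x ∧ f x ≤ F1)
    (hsum : ∀ x y, ∑ v ∈ cl s b x y, f v = ∑ v ∈ cl s b (!x) (!y), f v) :
    ∃ C : SimpleGraph V, (∀ u v, C.Adj u v → G.Adj u v ∧ ¬ D.Adj u v ∧ s u ≠ s v ∧ b u ≠ b v) ∧ ∀ v, dg C v = f v := by
  have key : ∀ y : Bool, ∃ C : V → V → Prop, (∀ u v, C u v → u ∈ cl s b true y ∧ v ∈ cl s b false (!y) ∧ (G.Adj u v ∧ ¬ D.Adj u v)) ∧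
      (∀ u ∈ cl s b true y, (univ.filter (fun v => C u v)).card = f u) ∧
      (∀ v ∈ cl s b false (!y), (univ.filter (fun u => C u v)).card = f v) := by
    intro y
    have g1 : ∀ x y : Bool, ∀ v ∈ cl s b x y, (0.249 : ℝ) * d ≤ (((cl s b (!x) (!y)).filter (G.Adj v)).card : ℝ) := by
      intro x y v hv
      refine (hG v).trans ?_
      rw [card_filter_cnt]
      rw [mem_cl] at hv
      refine Nat.cast_le.2 (cnt_mono ?_)
      rintro u ⟨h1, h2, h3⟩
      rw [mem_cl, ← hv.1, ← hv.2]
      refine ⟨⟨?_, ?_⟩, h1⟩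
      · revert h2; cases s u <;> cases s v <;> decide
      · revert h3; cases b u <;> cases b v <;> decide
    have g2 : ∀ x y : Bool, ∀ v ∈ cl s b x y, (((cl s b (!x) (!y)).filter (D.Adj v)).card) ≤ Rm := by
      intro x y v hv
      refine le_trans ?_ (hD v)
      rw [card_filter_cnt]
      rw [mem_cl] at hv
      refine cnt_mono ?_
      rintro u ⟨h1, h2⟩
      rw [mem_cl, ← hv.1, ← hv.2] at h1
      refine ⟨h2, ?_⟩
      rw [h1.1]; simp
    have k1 := g1 true y
    have k2 := g1 false (!y)
    have k3 := g2 true y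
    have k4 := g2 false (!y)
    have k5 := hsum true y
    have k6 := hcc true y
    rw [Bool.not_false, Bool.not_not] at k2 k4
    rw [Bool.not_true] at k1 k3 k5 k6
    exact hall_factor G D d hmix (cl s b true y) (cl s b false (!y)) hn k6 (hcl true y).1 (hcl true y).2
      Rm F0 F1 hRm hF k1 k2 k3 k4 f hf k5
  clear hsum hcc hcl hG hD hf hmix
  choose C hC1 hC2 hC3 using key
  simp only [mem_cl] at hC1 hC2 hC3
  have hs : ∀ u v, (C true u v ∨ C false u v) → s u ≠ s v := by
    rintro u v (h | h) <;> simp [hC1 _ u v h]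
  refine ⟨relG (fun u v => C true u v ∨ C false u v) s hs, ?_, ?_⟩
  · have key : ∀ u v, (C true u v ∨ C false u v) → G.Adj u v ∧ ¬ D.Adj u v ∧ s u ≠ s v ∧ b u ≠ b v := by
      rintro u v (h | h)
      · obtain ⟨h1, h2, h3⟩ := hC1 _ u v h
        refine ⟨h3.1, h3.2, by simp [h1, h2], by simp [h1, h2]⟩
      · obtain ⟨h1, h2, h3⟩ := hC1 _ u v h
        refine ⟨h3.1, h3.2, by simp [h1, h2], by simp [h1, h2]⟩
    rintro u v (h | h)
    · exact key u v h
    · have := key v u h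
      rw [G.adj_comm, D.adj_comm]
      exact ⟨this.1, this.2.1, this.2.2.1.symm, this.2.2.2.symm⟩
  · intro v
    rcases hsv : s v with _ | _
    · rw [← hC3 (!b v) v ⟨hsv, by simp⟩]
      apply cnt_congr
      intro u
      simp only [relG]
      constructor
      · rintro ((h | h) | (h | h))
        · have := (hC1 _ _ _ h).1.1; simp_all
        · have := (hC1 _ _ _ h).1.1; simp_all
        · have := (hC1 _ _ _ h).2.1.2; simp_all
        · have := (hC1 _ _ _ h).2.1.2; simp_all
      · intro h
        right
        cases hb : b v <;> simp_all
    · rw [← hC2 (b v) v ⟨hsv, rfl⟩]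
      apply cnt_congr
      intro u
      simp only [relG]
      constructor
      · rintro ((h | h) | (h | h))
        · have := (hC1 _ _ _ h).1.2; simp_all
        · have := (hC1 _ _ _ h).1.2; simp_all
        · have := (hC1 _ _ _ h).2.1.1; simp_all
        · have := (hC1 _ _ _ h).2.1.1; simp_all
      · intro h
        left
        cases hb : b v <;> simp_all

lemma assembly {V : Type*} [Fintype V] (G : SimpleGraph V) (d : ℕ) (hmix : Mix G d)
    (hn : (0 : ℝ) < Fintype.card V) (hreg : ∀ v, dg G v = d) (m : ℕ) (s : V → Bool) (b : ℕ → V → Bool)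
    (hcl : ∀ i < m, ∀ x y, (0.249 : ℝ) * Fintype.card V ≤ (cl s (b i) x y).card ∧
      ((cl s (b i) x y).card : ℝ) ≤ 0.251 * Fintype.card V)
    (hcc : ∀ i < m, ∀ x y, (cl s (b i) x y).card = (cl s (b i) (!x) (!y)).card)
    (F0 F1 : ℕ) (hRm : (m : ℝ) * F1 ≤ d / 100) (hF : 10 * F1 ≤ 11 * F0)
    (hG : ∀ i < m, ∀ v, (0.249 : ℝ) * d ≤ cnt (fun u => G.Adj v u ∧ s u ≠ s v ∧ b i u ≠ b i v))
    (F : ℕ → SimpleGraph V) (r : ℕ → ℕ)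
    (hFG : ∀ i < m, ∀ u v, (F i).Adj u v → G.Adj u v ∧ s u = s v ∧ b i u ≠ b i v)
    (hFF : ∀ i < m, ∀ j < m, i ≠ j → ∀ u v, (F i).Adj u v → ¬ (F j).Adj u v)
    (hcov : ∀ u v, G.Adj u v → s u = s v → ∃ i < m, (F i).Adj u v)
    (hf : ∀ i < m, ∀ v, dg (F i) v + F0 ≤ r i ∧ r i ≤ dg (F i) v + F1)
    (hsum : ∀ i < m, ∀ x y, ∑ v ∈ cl s (b i) x y, dg (F i) v = ∑ v ∈ cl s (b i) (!x) (!y), dg (F i) v) :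
    Fac G d := by
  have main : ∀ i ≤ m, ∃ D : SimpleGraph V, D ≤ G ∧ Fac D (∑ j ∈ range i, r j) ∧
      (∀ u v, s u = s v → (D.Adj u v ↔ ∃ j < i, (F j).Adj u v)) ∧
      ∀ v, cnt (fun u => D.Adj v u ∧ s u ≠ s v) ≤ i * F1 := by
    intro i
    induction i with
    | zero =>
      intro _
      refine ⟨⊥, bot_le, ⟨fun _ _ => 0, by simp, by simp, by simp⟩, by simp, ?_⟩
      intro v
      simp [cnt]
    | succ i ih =>
      intro hi
      obtain ⟨D, hDG, hDF, hDi, hDc⟩ := ih (by omega)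
      have him : i < m := by omega
      obtain ⟨C, hC1, hC2⟩ := cross_exists G D d hmix hn s (b i) (hcl i him) (hcc i him) (i * F1) F0 F1
        (by
          refine le_trans ?_ hRm
          have : i * F1 + F1 ≤ m * F1 := by
            have := Nat.mul_le_mul_right F1 hi
            rw [Nat.succ_mul] at this
            exact this
          exact_mod_cast this) hF (hG i him) hDc (fun v => r i - dg (F i) v)
        (fun v => by have := hf i him v; omega)
        (by
          intro x y
          have h1 := hsum i him x y
          have h2 := hcc i him x y
          have h3 : ∀ T : Finset V, ∑ v ∈ T, (r i - dg (F i) v) + ∑ v ∈ T, dg (F i) v = T.card * r i := by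
            intro T
            rw [← sum_add_distrib, Finset.sum_congr rfl (g := fun _ => r i)]
            · simp
            · intro v _
              have := hf i him v; omega
          have h4 := h3 (cl s (b i) x y)
          have h5 := h3 (cl s (b i) (!x) (!y))
          rw [h2] at h4
          omega)
      have hFC : ∀ u v, (F i).Adj u v → ¬ C.Adj u v := fun u v h h' => (hC1 u v h').2.2.1 (hFG i him u v h).2.1
      have hK : Fac (F i ⊔ C) (r i) := by
        refine konig (r i) _ (b i) ?_ ?_
        · rintro u v (h | h)
          · exact (hFG i him u v h).2.2
          · exact (hC1 u v h).2.2.2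
        · intro v
          rw [dg_sup hFC, hC2]
          have := hf i him v; omega
      refine ⟨D ⊔ (F i ⊔ C), ?_, ?_, ?_, ?_⟩
      · refine sup_le hDG (sup_le ?_ ?_)
        · intro u v h
          exact (hFG i him u v h).1
        · intro u v h
          exact (hC1 u v h).1
      · rw [sum_range_succ]
        refine hDF.add ?_ hK
        rintro u v h (h' | h')
        · obtain ⟨j, hj, hj'⟩ := (hDi u v (hFG i him u v h').2.1).1 h
          exact hFF j (by omega) i him (by omega) u v hj' h'
        · exact (hC1 u v h').2.1 h
      · intro u v huv
        constructor
        · rintro (h | h | h)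
          · obtain ⟨j, hj, hj'⟩ := (hDi u v huv).1 h
            exact ⟨j, by omega, hj'⟩
          · exact ⟨i, by omega, h⟩
          · exact absurd huv (hC1 u v h).2.2.1
        · rintro ⟨j, hj, hj'⟩
          rcases Nat.lt_succ_iff_lt_or_eq.1 hj with h | h
          · exact Or.inl ((hDi u v huv).2 ⟨j, h, hj'⟩)
          · subst h
            exact Or.inr (Or.inl hj')
      · intro v
        have h1 : cnt (fun u => (D ⊔ (F i ⊔ C)).Adj v u ∧ s u ≠ s v) ≤
            cnt (fun u => (D.Adj v u ∧ s u ≠ s v) ∨ C.Adj v u) := by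
          apply cnt_mono
          rintro u ⟨h | h | h, h'⟩
          · exact Or.inl ⟨h, h'⟩
          · exact absurd (hFG i him v u h).2.1.symm h'
          · exact Or.inr h
        have h2 := cnt_or_le (fun u => D.Adj v u ∧ s u ≠ s v) (C.Adj v)
        have h3 : cnt (C.Adj v) = r i - dg (F i) v := hC2 v
        have h4 := hDc v
        have h5 := hf i him v
        rw [Nat.succ_mul]
        omega
  obtain ⟨D, hDG, hDF, hDi, -⟩ := main m le_rfl
  rcases isEmpty_or_nonempty V with hV | hV
  · exact ⟨fun _ _ => 0, by simp, fun u => (hV.false u).elim, fun u => (hV.false u).elim⟩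
  have hk : Fac (G \ D) (d - ∑ j ∈ range m, r j) := by
    refine konig _ _ s ?_ ?_
    · rintro u v ⟨h1, h2⟩ h
      apply h2
      exact (hDi u v h).2 (hcov u v h1 h)
    · intro v
      have h1 := dg_sdiff hDG v
      rw [hDF.dg, hreg] at h1
      omega
  have h := hDF.add (by rintro u v h ⟨_, h'⟩; exact h' h) hk
  rw [sup_sdiff_cancel_right hDG] at h
  obtain ⟨v⟩ := hV
  have h1 := dg_sdiff hDG v
  rw [hDF.dg, hreg] at h1
  rwa [Nat.add_sub_cancel' (by omega)] at h

lemma dg_mono {V : Type*} [Fintype V] {H K : SimpleGraph V} (h : H ≤ K) (v : V) : dg H v ≤ dg K v :=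
  cnt_mono fun u hu => h hu

lemma sum_dg_symm {V : Type*} [Fintype V] (H : SimpleGraph V) (T : Finset V) :
    ∑ v, cnt (fun u => H.Adj v u ∧ u ∈ T) = ∑ v ∈ T, dg H v := by
  have h := ec_comm H univ T
  unfold ec at h
  refine Eq.trans (sum_congr rfl fun v _ => ?_) (h.trans (sum_congr rfl fun v _ => rfl))
  rw [card_filter_cnt]
  exact cnt_congr fun u => and_comm

lemma greedy {V : Type*} [Fintype V] (H : SimpleGraph V) (Δ k : ℕ) (hk : 1 ≤ k) (hΔ : ∀ v, dg H v ≤ Δ) :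
    ∀ M : ℕ, 4 * M * Δ + 2 * M * k < k * ∑ v, dg H v →
      ∃ S : SimpleGraph V, S ≤ H ∧ ∑ v, dg S v = 2 * M ∧ ∀ v, dg S v ≤ k := by
  intro M
  induction M with
  | zero =>
    intro _
    have h0 : ∀ v : V, dg (⊥ : SimpleGraph V) v = 0 := by intro v; simp [dg]
    exact ⟨⊥, bot_le, by simp [h0], by simp [h0]⟩
  | succ M ih =>
    intro hM
    have hM' : 4 * M * Δ + 2 * M * k < k * ∑ v, dg H v := by
      refine lt_of_le_of_lt ?_ hM
      gcongr <;> omega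
    obtain ⟨S, hSH, hS2, hSk⟩ := ih hM'
    obtain ⟨u, v, huv, hnS, hu, hv⟩ : ∃ u v, H.Adj u v ∧ ¬ S.Adj u v ∧ dg S u < k ∧ dg S v < k := by
      by_contra hcon
      push Not at hcon
      let T : Finset V := univ.filter (fun v => k ≤ dg S v)
      have h1 : ∀ v, dg (H \ S) v + dg S v = dg H v := fun v => dg_sdiff hSH v
      have h2 : ∑ v, dg (H \ S) v + 2 * M = ∑ v, dg H v := by
        rw [← hS2, ← sum_add_distrib]
        exact sum_congr rfl fun v _ => h1 v
      have h3 : ∑ v, dg (H \ S) v ≤ 2 * ∑ v ∈ T, dg (H \ S) v := by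
        have h4 : ∀ v, dg (H \ S) v ≤ (if v ∈ T then dg (H \ S) v else 0) + cnt (fun u => (H \ S).Adj v u ∧ u ∈ T) := by
          intro v
          by_cases hv : v ∈ T
          · simp [hv]
          · simp only [hv, if_false, zero_add]
            apply cnt_mono
            intro u hu
            refine ⟨hu, ?_⟩
            simp only [T, mem_filter, mem_univ, true_and] at hv ⊢
            exact hcon v u hu.1 hu.2 (by omega)
        refine (sum_le_sum fun v _ => h4 v).trans ?_
        rw [sum_add_distrib, sum_dg_symm, ← sum_filter]
        have : (univ.filter (fun v => v ∈ T)) = T := by ext; simp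
        rw [this]; omega
      have h5 : ∑ v ∈ T, dg (H \ S) v ≤ T.card * Δ := by
        have := Finset.sum_le_card_nsmul T (fun v => dg (H \ S) v) Δ (fun v _ => by have := h1 v; have := hΔ v; omega)
        simpa using this
      have h6 : T.card * k ≤ 2 * M := by
        have := Finset.card_nsmul_le_sum T (fun v => dg S v) k (fun v hv => (mem_filter.1 hv).2)
        rw [← hS2]
        refine le_trans (by simpa using this) (sum_le_sum_of_subset (subset_univ _))
      have h7 : k * ∑ v, dg (H \ S) v ≤ 4 * M * Δ := by
        calc k * ∑ v, dg (H \ S) v ≤ k * (2 * (T.card * Δ)) := by gcongr; omega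
          _ = (T.card * k) * (2 * Δ) := by ring
          _ ≤ (2 * M) * (2 * Δ) := by gcongr
          _ = _ := by ring
      rw [← h2] at hM'
      nlinarith
    have hne : u ≠ v := huv.ne
    let e : SimpleGraph V := SimpleGraph.edge u v
    have hSe : ∀ x y, S.Adj x y → ¬ e.Adj x y := by
      intro x y h h'
      simp only [e, SimpleGraph.edge_adj] at h'
      rcases h'.1 with ⟨rfl, rfl⟩ | ⟨rfl, rfl⟩
      · exact hnS h
      · exact hnS h.symm
    have hde : ∀ x, dg e x = if x = u ∨ x = v then 1 else 0 := by
      intro x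
      split_ifs with hx
      · unfold dg
        rw [card_eq_one]
        rcases hx with rfl | rfl
        · refine ⟨v, ?_⟩
          ext y
          simp only [mem_filter, mem_univ, true_and, mem_singleton, e, SimpleGraph.edge_adj]
          grind
        · refine ⟨u, ?_⟩
          ext y
          simp only [mem_filter, mem_univ, true_and, mem_singleton, e, SimpleGraph.edge_adj]
          grind
      · unfold dg
        rw [card_eq_zero]
        ext y
        simp only [mem_filter, mem_univ, true_and, e, SimpleGraph.edge_adj]
        grind
    refine ⟨S ⊔ e, sup_le hSH ?_, ?_, ?_⟩
    · intro x y h'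
      simp only [e, SimpleGraph.edge_adj] at h'
      rcases h'.1 with ⟨rfl, rfl⟩ | ⟨rfl, rfl⟩
      · exact huv
      · exact huv.symm
    · have : ∑ x, dg e x = 2 := by
        simp only [hde]
        rw [← sum_filter]
        simp only [sum_const, smul_eq_mul, mul_one]
        have : univ.filter (fun x => x = u ∨ x = v) = {u, v} := by ext; simp
        rw [this, card_pair hne]
      simp only [dg_sup hSe]
      rw [sum_add_distrib, hS2, this]; ring
    · intro x
      rw [dg_sup hSe, hde]
      split_ifs with hx
      · rcases hx with rfl | rfl <;> omega
      · exact hSk x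

/-- degree sum on one side -/
noncomputable def sD {V : Type*} [Fintype V] (s : V → Bool) (H : SimpleGraph V) (x : Bool) : ℕ :=
  ∑ v ∈ univ.filter (fun v => s v = x), dg H v

lemma bip_sum {V : Type*} [Fintype V] (s b : V → Bool) (H : SimpleGraph V)
    (hH : ∀ u v, H.Adj u v → s u = s v ∧ b u ≠ b v) (x y : Bool) :
    2 * ∑ v ∈ cl s b x y, dg H v = sD s H x := by
  have h1 : ∀ x y, ∑ v ∈ cl s b x y, dg H v = ec H (cl s b x y) (cl s b x (!y)) := by
    intro x y
    unfold ec
    refine sum_congr rfl fun v hv => ?_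
    rw [card_filter_cnt]
    refine cnt_congr fun u => ?_
    rw [mem_cl] at hv ⊢
    constructor
    · intro h
      have := hH _ _ h
      refine ⟨⟨this.1 ▸ hv.1, ?_⟩, h⟩
      rw [← hv.2]
      have := this.2
      revert this
      cases b v <;> cases b u <;> decide
    · exact fun h => h.2
  have h2 : ∑ v ∈ cl s b x y, dg H v = ∑ v ∈ cl s b x (!y), dg H v := by
    rw [h1, h1, Bool.not_not, ec_comm]
  have h3 : sD s H x = ∑ v ∈ cl s b x y, dg H v + ∑ v ∈ cl s b x (!y), dg H v := by
    unfold sD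
    rw [← sum_union]
    · apply sum_congr _ fun _ _ => rfl
      ext v
      simp only [mem_filter, mem_univ, true_and, mem_union, mem_cl]
      cases b v <;> cases y <;> simp
    · rw [disjoint_left]
      intro v h h'
      rw [mem_cl] at h h'
      rw [h.2] at h'
      have := h'.2
      cases y <;> simp at this
  rw [h3, ← h2]; ring

lemma sD_sup {V : Type*} [Fintype V] (s : V → Bool) {H K : SimpleGraph V}
    (h : ∀ u v, H.Adj u v → ¬ K.Adj u v) (x : Bool) : sD s (H ⊔ K) x = sD s H x + sD s K x := by
  unfold sD
  simp only [dg_sup h]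
  rw [sum_add_distrib]

lemma balance_step {V : Type*} [Fintype V] (s : V → Bool) (h : ℕ) (h0 : 0 < h)
    (hs : ∀ x, (univ.filter (fun v => s v = x)).card = h)
    (Fi H : SimpleGraph V) (E2 L Δ k : ℕ) (hE : 1 ≤ E2) (hk : k = 4 * E2)
    (hnum : Δ + 2 * E2 < 2 * L) (heven : ∀ x, Even (sD s Fi x))
    (hFi : ∀ v w, dg Fi v ≤ dg Fi w + E2)
    (hHs : ∀ u v, H.Adj u v → s u = s v)
    (hL : ∀ v, L ≤ dg H v) (hΔ : ∀ v, dg H v ≤ Δ) :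
    ∃ Mi : SimpleGraph V, Mi ≤ H ∧ (∀ v, dg Mi v ≤ k) ∧
      sD s Fi true + sD s Mi true = sD s Fi false + sD s Mi false := by
  have key : ∀ x : Bool, sD s Fi x ≤ sD s Fi (!x) → ∃ Mi : SimpleGraph V, Mi ≤ H ∧ (∀ v, dg Mi v ≤ k) ∧
      sD s Fi x + sD s Mi x = sD s Fi (!x) + sD s Mi (!x) := by
    intro x hx
    have hne : ∃ w, w ∈ univ.filter (fun v => s v = x) := by
      apply Finset.Nonempty.exists_mem
      rw [← card_pos, hs]; exact h0
    have hdiff : sD s Fi (!x) ≤ sD s Fi x + h * E2 := by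
      obtain ⟨w, hw, hmin⟩ := Finset.exists_min_image (univ.filter (fun v => s v = x)) (fun v => dg Fi v) hne
      have h1 : sD s Fi (!x) ≤ h * (dg Fi w + E2) := by
        have := Finset.sum_le_card_nsmul (univ.filter (fun v => s v = !x)) (fun v => dg Fi v) (dg Fi w + E2) (fun v _ => hFi v w)
        rw [hs] at this
        simpa [sD] using this
      have h2 : h * dg Fi w ≤ sD s Fi x := by
        have := Finset.card_nsmul_le_sum (univ.filter (fun v => s v = x)) (fun v => dg Fi v) (dg Fi w) hmin
        rw [hs] at this
        simpa [sD] using this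
      nlinarith
    obtain ⟨a, ha⟩ := heven x
    obtain ⟨c, hc⟩ := heven (!x)
    let Hx : SimpleGraph V :=
      { Adj := fun u v => H.Adj u v ∧ s u = x
        symm := ⟨fun u v h => ⟨h.1.symm, (hHs u v h.1) ▸ h.2⟩⟩
        loopless := ⟨fun u h => H.loopless.irrefl u h.1⟩ }
    have hHx : Hx ≤ H := fun u v h => h.1
    have hdx : ∀ v, s v = x → dg Hx v = dg H v := by
      intro v hv
      exact cnt_congr fun u => ⟨fun h => h.1, fun h => ⟨h, hv⟩⟩
    have hsx : ∀ K : SimpleGraph V, K ≤ Hx → ∀ v, s v ≠ x → dg K v = 0 := by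
      intro K hK v hv
      unfold dg
      rw [card_eq_zero]
      ext u
      simp only [mem_filter, mem_univ, true_and]
      constructor
      · intro h; exact absurd (hK h).2 hv
      · intro h; simp at h
    have htot : ∀ K : SimpleGraph V, K ≤ Hx → ∑ v, dg K v = sD s K x := by
      intro K hK
      unfold sD
      symm
      apply sum_subset (subset_univ _)
      intro v _ hv
      apply hsx K hK
      simpa using hv
    have hnot : ∀ K : SimpleGraph V, K ≤ Hx → sD s K (!x) = 0 := by
      intro K hK
      unfold sD
      apply sum_eq_zero
      intro v hv
      apply hsx K hK
      rw [(mem_filter.1 hv).2]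
      cases x <;> simp
    obtain ⟨S, hSH, hS2, hSk⟩ := greedy Hx Δ k (by omega) (fun v => (dg_mono hHx v).trans (hΔ v)) (c - a) (by
      have h1 : h * L ≤ ∑ v, dg Hx v := by
        rw [htot Hx le_rfl]
        have := Finset.card_nsmul_le_sum (univ.filter (fun v => s v = x)) (fun v => dg Hx v) L (fun v hv => by
          rw [hdx v (mem_filter.1 hv).2]; exact hL v)
        rw [hs] at this
        simpa [sD] using this
      have h2 : 2 * (c - a) ≤ h * E2 := by omega
      calc 4 * (c - a) * Δ + 2 * (c - a) * k = (2 * (c - a)) * (2 * Δ + k) := by ring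
        _ ≤ (h * E2) * (2 * Δ + k) := by gcongr
        _ = (h * E2 * 2) * (Δ + 2 * E2) := by rw [hk]; ring
        _ < (h * E2 * 2) * (2 * L) := by
            apply Nat.mul_lt_mul_of_pos_left hnum
            positivity
        _ = k * (h * L) := by rw [hk]; ring
        _ ≤ _ := by gcongr)
    refine ⟨S, hSH.trans hHx, hSk, ?_⟩
    rw [hnot S hSH, ← htot S hSH, hS2]
    omega
  rcases le_total (sD s Fi true) (sD s Fi false) with hle | hle
  · exact key true hle
  · obtain ⟨S, h1, h2, h3⟩ := key false hle
    exact ⟨S, h1, h2, h3.symm⟩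

/-- raw pieces -/
def rawF {V : Type*} (G : SimpleGraph V) (s : V → Bool) (b : ℕ → V → Bool) (i : ℕ) : SimpleGraph V where
  Adj u v := G.Adj u v ∧ s u = s v ∧ b i u ≠ b i v ∧ ∀ j < i, b j u = b j v
  symm := ⟨fun u v h => ⟨h.1.symm, h.2.1.symm, h.2.2.1.symm, fun j hj => (h.2.2.2 j hj).symm⟩⟩
  loopless := ⟨fun u h => G.loopless.irrefl u h.1⟩

lemma sum_parts {V : Type*} [Fintype V] (m : ℕ) (F : ℕ → SimpleGraph V) (P : V → V → Prop)
    (hFF : ∀ i < m, ∀ j < m, i ≠ j → ∀ u v, (F i).Adj u v → ¬ (F j).Adj u v)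
    (hP : ∀ u v, P u v ↔ ∃ i < m, (F i).Adj u v) (v : V) :
    ∑ i ∈ range m, dg (F i) v = cnt (P v) := by
  unfold dg cnt
  rw [← card_biUnion]
  · congr 1
    ext u
    simp [hP]
  · intro i hi j hj hij
    rw [Function.onFun, disjoint_left]
    intro u h h'
    exact hFF i (mem_range.1 (mem_coe.1 hi)) j (mem_range.1 (mem_coe.1 hj)) hij v u (mem_filter.1 h).2 (mem_filter.1 h').2

lemma sum_parts_le {V : Type*} [Fintype V] (m : ℕ) (F : ℕ → SimpleGraph V) (P : V → V → Prop)
    (hP : ∀ u v, P u v → ∃ i < m, (F i).Adj u v) (v : V) :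
    cnt (P v) ≤ ∑ i ∈ range m, dg (F i) v := by
  unfold dg cnt
  refine le_trans (card_le_card ?_) card_biUnion_le
  intro u hu
  simp only [mem_filter, mem_univ, true_and, mem_biUnion, mem_range] at hu ⊢
  exact hP v u hu

lemma moves {V : Type*} [Fintype V] (G : SimpleGraph V) (s : V → Bool) (b : ℕ → V → Bool) (m h : ℕ) (h0 : 0 < h)
    (hs : ∀ x, (univ.filter (fun v => s v = x)).card = h)
    (E2 L Δ k : ℕ) (hE : 1 ≤ E2) (hk : k = 4 * E2)
    (hnum : Δ + 2 * E2 + 2 * (m * k) < 2 * L)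
    (hFi : ∀ i < m, ∀ v w, dg (rawF G s b i) v ≤ dg (rawF G s b i) w + E2)
    (hL : ∀ i < m, 0 < i → ∀ v, L ≤ cnt (fun u => G.Adj v u ∧ s v = s u ∧ b 0 v ≠ b 0 u ∧ b i v ≠ b i u))
    (hΔ : ∀ i < m, 0 < i → ∀ v, cnt (fun u => G.Adj v u ∧ s v = s u ∧ b 0 v ≠ b 0 u ∧ b i v ≠ b i u) ≤ Δ) :
    ∀ j ≤ m, ∃ Mv : ℕ → SimpleGraph V, (∀ i, Mv i ≤ rawF G s b 0) ∧ (∀ i u v, (Mv i).Adj u v → b i u ≠ b i v) ∧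
      (∀ i i', i ≠ i' → ∀ u v, (Mv i).Adj u v → ¬ (Mv i').Adj u v) ∧ (∀ i v, dg (Mv i) v ≤ k) ∧
      (∀ i, j ≤ i → Mv i = ⊥) ∧ Mv 0 = ⊥ ∧ ∀ i < j, 0 < i →
        sD s (rawF G s b i) true + sD s (Mv i) true = sD s (rawF G s b i) false + sD s (Mv i) false := by
  intro j
  induction j with
  | zero =>
    intro _
    exact ⟨fun _ => ⊥, fun _ => bot_le, by simp, by simp, by simp [dg], by simp, rfl, by simp⟩
  | succ j ih =>
    intro hj
    obtain ⟨Mv, m1, m2, m3, m4, m5, m6, m7⟩ := ih (by omega)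
    rcases Nat.eq_zero_or_pos j with hj0 | hj0
    · refine ⟨Mv, m1, m2, m3, m4, fun i hi => m5 i (by omega), m6, fun i hi hi' => by omega⟩
    let H : SimpleGraph V :=
      { Adj := fun u v => (G.Adj u v ∧ s u = s v ∧ b 0 u ≠ b 0 v ∧ b j u ≠ b j v) ∧ ∀ i, ¬ (Mv i).Adj u v
        symm := ⟨fun u v h => ⟨⟨h.1.1.symm, h.1.2.1.symm, h.1.2.2.1.symm, h.1.2.2.2.symm⟩, fun i hi => h.2 i hi.symm⟩⟩
        loopless := ⟨fun u h => G.loopless.irrefl u h.1.1⟩ }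
    obtain ⟨S, hSH, hSk, hSb⟩ := balance_step s h h0 hs (rawF G s b j) H E2 (L - m * k) Δ k hE hk (by omega)
      (fun x => ⟨_, (bip_sum s (b j) (rawF G s b j) (fun u v h => ⟨h.2.1, h.2.2.1⟩) x true).symm.trans (two_mul _)⟩)
      (hFi j (by omega)) (fun u v h => h.1.2.1)
      (by
        intro v
        have h1 := hL j (by omega) hj0 v
        have h2 : cnt (fun u => G.Adj v u ∧ s v = s u ∧ b 0 v ≠ b 0 u ∧ b j v ≠ b j u) ≤
            cnt (fun u => H.Adj v u ∨ ∃ i < m, (Mv i).Adj v u) := by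
          apply cnt_mono
          intro u hu
          by_cases hh : ∀ i, ¬ (Mv i).Adj v u
          · exact Or.inl ⟨hu, hh⟩
          · push Not at hh
            obtain ⟨i, hi⟩ := hh
            refine Or.inr ⟨i, ?_, hi⟩
            by_contra hcon
            rw [m5 i (by omega)] at hi
            exact hi
        have h3 := cnt_or_le (H.Adj v) (fun u => ∃ i < m, (Mv i).Adj v u)
        have h4 := sum_parts_le m Mv (fun v u => ∃ i < m, (Mv i).Adj v u) (fun u v h => h) v
        have h5 : ∑ i ∈ range m, dg (Mv i) v ≤ m * k := by
          have := Finset.sum_le_card_nsmul (range m) (fun i => dg (Mv i) v) k (fun i _ => m4 i v)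
          simpa using this
        have h6 : cnt (H.Adj v) = dg H v := rfl
        omega)
      (by
        intro v
        refine le_trans (cnt_mono ?_) (hΔ j (by omega) hj0 v)
        intro u hu
        exact hu.1)
    have hSraw : S ≤ rawF G s b 0 := by
      intro u v hh
      have := hSH hh
      exact ⟨this.1.1, this.1.2.1, this.1.2.2.1, by simp⟩
    refine ⟨Function.update Mv j S, ?_, ?_, ?_, ?_, ?_, ?_, ?_⟩
    · intro i
      by_cases hi : i = j
      · subst hi; simpa using hSraw
      · simpa [hi] using m1 i
    · intro i u v
      by_cases hi : i = j
      · subst hi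
        simp only [Function.update_self]
        intro hh
        exact (hSH hh).1.2.2.2
      · simpa [hi] using m2 i u v
    · intro i i' hii u v
      by_cases hi : i = j
      · subst hi
        simp only [Function.update_self, Function.update_of_ne hii.symm]
        intro hh
        exact (hSH hh).2 i'
      · simp only [Function.update_of_ne hi]
        by_cases hi' : i' = j
        · subst hi'
          simp only [Function.update_self]
          intro hh hh'
          exact (hSH hh').2 i hh
        · simp only [Function.update_of_ne hi']
          exact m3 i i' hii u v
    · intro i v
      by_cases hi : i = j
      · subst hi; simpa using hSk v
      · simpa [hi] using m4 i v
    · intro i hi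
      rw [Function.update_of_ne (by omega)]
      exact m5 i (by omega)
    · rw [Function.update_of_ne (by omega)]
      exact m6
    · intro i hi hi'
      by_cases hij : i = j
      · subst hij
        simpa using hSb
      · rw [Function.update_of_ne hij]
        exact m7 i (by omega) hi'

lemma balance {V : Type*} [Fintype V] (G : SimpleGraph V) (d : ℕ) (hreg : ∀ v, dg G v = d)
    (s : V → Bool) (b : ℕ → V → Bool) (m h : ℕ) (hm : 0 < m) (h0 : 0 < h)
    (hs : ∀ x, (univ.filter (fun v => s v = x)).card = h)
    (hdiff : ∀ u v, G.Adj u v → s u = s v → ∃ i < m, b i u ≠ b i v)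
    (E2 L Δ k : ℕ) (hE : 1 ≤ E2) (hk : k = 4 * E2)
    (hnum : Δ + 2 * E2 + 2 * (m * k) < 2 * L)
    (hFi : ∀ i < m, ∀ v w, dg (rawF G s b i) v ≤ dg (rawF G s b i) w + E2)
    (hL : ∀ i < m, 0 < i → ∀ v, L ≤ cnt (fun u => G.Adj v u ∧ s v = s u ∧ b 0 v ≠ b 0 u ∧ b i v ≠ b i u))
    (hΔ : ∀ i < m, 0 < i → ∀ v, cnt (fun u => G.Adj v u ∧ s v = s u ∧ b 0 v ≠ b 0 u ∧ b i v ≠ b i u) ≤ Δ) :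
    ∃ F : ℕ → SimpleGraph V, 
    (∀ i < m, ∀ u v, (F i).Adj u v → G.Adj u v ∧ s u = s v ∧ b i u ≠ b i v) ∧
    (∀ i < m, ∀ j < m, i ≠ j → ∀ u v, (F i).Adj u v → ¬ (F j).Adj u v) ∧
    (∀ u v, G.Adj u v → s u = s v → ∃ i < m, (F i).Adj u v) ∧
    (∀ i < m, ∀ v, dg (F i) v ≤ dg (rawF G s b i) v + k ∧ dg (rawF G s b i) v ≤ dg (F i) v + m * k) ∧
    (∀ i < m, ∀ x y, ∑ v ∈ cl s (b i) x y, dg (F i) v = ∑ v ∈ cl s (b i) (!x) (!y), dg (F i) v) := by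
  obtain ⟨Mv, m1, m2, m3, m4, m5, m6, m7⟩ := moves G s b m h h0 hs E2 L Δ k hE hk hnum hFi hL hΔ m le_rfl
  have hm0 : ∀ u v, ¬ (Mv 0).Adj u v := by rw [m6]; simp
  let F : ℕ → SimpleGraph V := fun i => if i = 0 then rawF G s b 0 \ (⨆ i, Mv i) else rawF G s b i ⊔ Mv i
  have hF0 : ∀ u v, (F 0).Adj u v ↔ (rawF G s b 0).Adj u v ∧ ∀ i, ¬ (Mv i).Adj u v := by
    intro u v
    simp [F]
  have hF1 : ∀ i, 0 < i → F i = rawF G s b i ⊔ Mv i := by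
    intro i hi
    simp [F, hi.ne']
  have hraw : ∀ i j, i < j → ∀ u v, (rawF G s b i).Adj u v → ¬ (rawF G s b j).Adj u v := by
    intro i j hij u v h1 h2
    exact h1.2.2.1 (h2.2.2.2 i hij)
  have g1 : ∀ i < m, ∀ u v, (F i).Adj u v → G.Adj u v ∧ s u = s v ∧ b i u ≠ b i v := by
    intro i hi u v huv
    rcases Nat.eq_zero_or_pos i with rfl | hi0
    · have := ((hF0 u v).1 huv).1
      exact ⟨this.1, this.2.1, this.2.2.1⟩
    · rw [hF1 i hi0] at huv
      rcases huv with huv | huv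
      · exact ⟨huv.1, huv.2.1, huv.2.2.1⟩
      · exact ⟨(m1 i huv).1, (m1 i huv).2.1, m2 i u v huv⟩
  have g2' : ∀ i < m, ∀ j < m, i < j → ∀ u v, (F i).Adj u v → ¬ (F j).Adj u v := by
    intro i hi j hj hij u v h1 h2
    rw [hF1 j (by omega)] at h2
    rcases Nat.eq_zero_or_pos i with rfl | hi0
    · rw [hF0] at h1
      rcases h2 with h2 | h2
      · exact hraw 0 j hij u v h1.1 h2
      · exact h1.2 j h2
    · rw [hF1 i hi0] at h1
      rcases h1 with h1 | h1 <;> rcases h2 with h2 | h2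
      · exact hraw i j hij u v h1 h2
      · exact hraw 0 i hi0 u v (m1 j h2) h1
      · exact hraw 0 j (by omega) u v (m1 i h1) h2
      · exact m3 i j hij.ne u v h1 h2
  have g2 : ∀ i < m, ∀ j < m, i ≠ j → ∀ u v, (F i).Adj u v → ¬ (F j).Adj u v := by
    intro i hi j hj hij u v h1 h2
    rcases lt_or_gt_of_ne hij with hlt | hlt
    · exact g2' i hi j hj hlt u v h1 h2
    · exact g2' j hj i hi hlt u v h2 h1
  have g3 : ∀ u v, G.Adj u v → s u = s v → ∃ i < m, (F i).Adj u v := by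
    intro u v huv hsuv
    have hex := hdiff u v huv hsuv
    obtain ⟨hi1, hi2⟩ := Nat.find_spec hex
    have hmin := fun j => Nat.find_min hex (m := j)
    set i := Nat.find hex with hidef
    have hr : (rawF G s b i).Adj u v := by
      refine ⟨huv, hsuv, hi2, ?_⟩
      intro j hj
      have := hmin j hj
      by_contra hcon
      exact this ⟨by omega, hcon⟩
    rcases Nat.eq_zero_or_pos i with hi0 | hi0
    · rw [hi0] at hr
      by_cases hh : ∀ i, ¬ (Mv i).Adj u v
      · exact ⟨0, hm, (hF0 u v).2 ⟨hr, hh⟩⟩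
      · push Not at hh
        obtain ⟨j, hj⟩ := hh
        have hj0 : 0 < j := by
          rcases Nat.eq_zero_or_pos j with rfl | hj'
          · exact absurd hj (hm0 u v)
          · exact hj'
        refine ⟨j, ?_, ?_⟩
        · by_contra hcon
          rw [m5 j (by omega)] at hj
          exact hj
        · rw [hF1 j hj0]
          exact Or.inr hj
    · refine ⟨i, hi1, ?_⟩
      rw [hF1 i hi0]
      exact Or.inl hr
  have hrM : ∀ i, 0 < i → ∀ u v, (rawF G s b i).Adj u v → ¬ (Mv i).Adj u v := by
    intro i hi u v h1 h2
    exact hraw 0 i hi u v (m1 i h2) h1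
  have g5 : ∀ i < m, sD s (F i) true = sD s (F i) false := by
    have g5' : ∀ i < m, 0 < i → sD s (F i) true = sD s (F i) false := by
      intro i hi hi0
      rw [hF1 i hi0, sD_sup s (hrM i hi0), sD_sup s (hrM i hi0)]
      exact m7 i hi hi0
    have htot : ∀ x, ∑ i ∈ range m, sD s (F i) x + ec G (univ.filter fun v => s v = x) (univ.filter fun v => s v = !x) = h * d := by
      intro x
      unfold sD
      rw [sum_comm, ec, ← sum_add_distrib]
      rw [sum_congr rfl (g := fun _ => d)]
      · rw [sum_const, hs]; simp
      · intro v hv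
        have hv' := (mem_filter.1 hv).2
        rw [sum_parts m F (fun u v => G.Adj u v ∧ s u = s v) g2 (fun u v => ⟨fun hh => g3 u v hh.1 hh.2, fun ⟨i, hi, hh⟩ => ⟨(g1 i hi u v hh).1, (g1 i hi u v hh).2.1⟩⟩) v,
          card_filter_cnt, ← hreg v, ← cnt_or]
        · apply cnt_congr
          intro u
          simp only [mem_filter, mem_univ, true_and, hv']
          constructor
          · rintro (hh | hh)
            · exact hh.1
            · exact hh.2
          · intro hh
            by_cases hx : x = s u
            · exact Or.inl ⟨hh, hx⟩
            · right
              refine ⟨?_, hh⟩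
              revert hx
              cases x <;> cases s u <;> decide
        · intro u hh hh'
          simp only [mem_filter, mem_univ, true_and] at hh'
          rw [← hh.2, hv'] at hh'
          have := hh'.1
          cases x <;> simp at this
    intro i hi
    rcases Nat.eq_zero_or_pos i with rfl | hi0
    · have t1 := htot true
      have t2 := htot false
      rw [ec_comm] at t2
      simp only [Bool.not_true, Bool.not_false] at t1 t2
      obtain ⟨m', rfl⟩ : ∃ m', m = m' + 1 := ⟨m - 1, by omega⟩
      rw [sum_range_succ'] at t1 t2
      have t3 : ∑ k ∈ range m', sD s (F (k + 1)) true = ∑ k ∈ range m', sD s (F (k + 1)) false :=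
        sum_congr rfl fun k hk => g5' (k+1) (by have := mem_range.1 hk; omega) (by omega)
      omega
    · exact g5' i hi hi0
  refine ⟨F, g1, g2, g3, ?_, ?_⟩
  · intro i hi v
    rcases Nat.eq_zero_or_pos i with rfl | hi0
    · constructor
      · refine le_trans (cnt_mono ?_) (Nat.le_add_right _ _)
        intro u hu
        exact ((hF0 v u).1 hu).1
      · have h2 : cnt ((rawF G s b 0).Adj v) ≤ cnt (fun u => (F 0).Adj v u ∨ ∃ i < m, (Mv i).Adj v u) := by
          apply cnt_mono
          intro u hu
          by_cases hh : ∀ i, ¬ (Mv i).Adj v u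
          · exact Or.inl ((hF0 v u).2 ⟨hu, hh⟩)
          · push Not at hh
            obtain ⟨i, hi⟩ := hh
            refine Or.inr ⟨i, ?_, hi⟩
            by_contra hcon
            rw [m5 i (by omega)] at hi
            exact hi
        have h3 := cnt_or_le ((F 0).Adj v) (fun u => ∃ i < m, (Mv i).Adj v u)
        have h4 := sum_parts_le m Mv (fun v u => ∃ i < m, (Mv i).Adj v u) (fun u v h => h) v
        have h5 : ∑ i ∈ range m, dg (Mv i) v ≤ m * k := by
          have := Finset.sum_le_card_nsmul (range m) (fun i => dg (Mv i) v) k (fun i _ => m4 i v)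
          simpa using this
        have h6 : cnt ((F 0).Adj v) = dg (F 0) v := rfl
        have h7 : cnt ((rawF G s b 0).Adj v) = dg (rawF G s b 0) v := rfl
        omega
    · rw [hF1 i hi0, dg_sup (hrM i hi0)]
      have := m4 i v
      constructor
      · omega
      · have : 0 ≤ m * k := Nat.zero_le _
        omega
  · intro i hi x y
    have e1 := bip_sum s (b i) (F i) (fun u v hh => (g1 i hi u v hh).2) x y
    have e2 := bip_sum s (b i) (F i) (fun u v hh => (g1 i hi u v hh).2) (!x) (!y)
    have e3 := g5 i hi
    cases x <;> simp only [Bool.not_true, Bool.not_false] at * <;> omega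

lemma det_main {V : Type*} [Fintype V] (G : SimpleGraph V) (d : ℕ) (hmix : Mix G d)
    (hn : (0 : ℝ) < Fintype.card V) (hreg : ∀ v, dg G v = d) (m : ℕ) (hm : 1 ≤ m) (s : V → Bool) (b : ℕ → V → Bool)
    (p : V ≃ V) (hps : ∀ v, s (p v) = !s v) (hpb : ∀ i < m, ∀ v, b i (p v) = !b i v)
    (hdiff : ∀ u v, G.Adj u v → s u = s v → ∃ i < m, b i u ≠ b i v)
    (E : ℕ) (hE : 1 ≤ E) (hd : 21000 * (m * (m * E)) ≤ d)
    (H1 : ∀ i < m, ∃ c : ℝ, 0 ≤ c ∧ ∀ v, |(dg (rawF G s b i) v : ℝ) - c| < E)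
    (H2 : ∀ i < m, ∀ x y v, |(cnt (fun u => G.Adj v u ∧ s u = x ∧ b i u = y) : ℝ) - d / 4| < E)
    (H3 : ∀ i < m, 0 < i → ∀ v,
      |(cnt (fun u => G.Adj v u ∧ s v = s u ∧ b 0 v ≠ b 0 u ∧ b i v ≠ b i u) : ℝ) - d / 8| < E) :
    Fac G d := by
  have hEm : E ≤ m * E := Nat.le_mul_of_pos_left _ hm
  have hmE : m * E ≤ m * (m * E) := Nat.le_mul_of_pos_left _ hm
  have hdE : (21000 : ℝ) * E ≤ d := by exact_mod_cast (by omega : 21000 * E ≤ d)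
  have hE0 : (1 : ℝ) ≤ E := by exact_mod_cast hE
  have hcc : ∀ i < m, ∀ x y, (cl s (b i) x y).card = (cl s (b i) (!x) (!y)).card := by
    intro i hi x y
    refine Finset.card_equiv p ?_
    intro v
    rw [mem_cl, mem_cl, hps, hpb i hi]
    simp
  have hss : ∀ x, (univ.filter (fun v => s v = x)).card = (univ.filter (fun v => s v = true)).card := by
    intro x
    cases x
    · refine Finset.card_equiv p ?_
      intro v
      simp [hps]
    · rfl
  have hh0 : 0 < (univ.filter (fun v => s v = true)).card := by
    have hV : 0 < Fintype.card V := by exact_mod_cast hn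
    obtain ⟨v⟩ := Fintype.card_pos_iff.1 hV
    rw [← hss (s v)]
    exact card_pos.2 ⟨v, by simp⟩
  have hcl : ∀ i < m, ∀ x y, (0.249 : ℝ) * Fintype.card V ≤ (cl s (b i) x y).card ∧
      ((cl s (b i) x y).card : ℝ) ≤ 0.251 * Fintype.card V := by
    intro i hi x y
    have h1 := sum_dg_symm G (cl s (b i) x y)
    have h2 : ∑ v ∈ cl s (b i) x y, dg G v = (cl s (b i) x y).card * d := by
      rw [sum_congr rfl (fun v _ => hreg v)]; simp
    have h3 : (∑ v, (cnt (fun u => G.Adj v u ∧ u ∈ cl s (b i) x y) : ℝ)) = (cl s (b i) x y).card * d := by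
      exact_mod_cast h1.trans h2
    have h4 : ∀ v, |(cnt (fun u => G.Adj v u ∧ u ∈ cl s (b i) x y) : ℝ) - d / 4| < E := by
      intro v
      have := H2 i hi x y v
      rwa [cnt_congr (Q := fun u => G.Adj v u ∧ u ∈ cl s (b i) x y) (fun u => by rw [mem_cl])] at this
    have h5 := Finset.sum_le_card_nsmul univ (fun v => (cnt (fun u => G.Adj v u ∧ u ∈ cl s (b i) x y) : ℝ)) (d / 4 + E)
      (fun v _ => by have := (abs_lt.1 (h4 v)).2; linarith)
    have h6 := Finset.card_nsmul_le_sum univ (fun v => (cnt (fun u => G.Adj v u ∧ u ∈ cl s (b i) x y) : ℝ)) (d / 4 - E)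
      (fun v _ => by have := (abs_lt.1 (h4 v)).1; linarith)
    rw [h3] at h5 h6
    simp only [nsmul_eq_mul, card_univ] at h5 h6
    set N : ℝ := ((Fintype.card V : ℕ) : ℝ)
    set C : ℝ := (((cl s (b i) x y).card : ℕ) : ℝ)
    have hd0 : (0 : ℝ) < d := by linarith
    have h7 : N * E ≤ N * (d / 1000) := mul_le_mul_of_nonneg_left (by linarith) hn.le
    constructor
    · refine le_of_mul_le_mul_right (?_ : _ * (d : ℝ) ≤ _ * d) hd0
      linarith
    · refine le_of_mul_le_mul_right (?_ : _ * (d : ℝ) ≤ _ * d) hd0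
      linarith
  have hG : ∀ i < m, ∀ v, (0.249 : ℝ) * d ≤ cnt (fun u => G.Adj v u ∧ s u ≠ s v ∧ b i u ≠ b i v) := by
    intro i hi v
    have := (abs_lt.1 (H2 i hi (!s v) (!b i v) v)).1
    rw [cnt_congr (Q := fun u => G.Adj v u ∧ s u ≠ s v ∧ b i u ≠ b i v)] at this
    · linarith
    · intro u
      cases s u <;> cases s v <;> cases b i u <;> cases b i v <;> simp
  choose! c hc0 hc using H1
  have hc1 : ∀ i < m, ∀ v, dg (rawF G s b i) v ≤ ⌈c i⌉₊ + E := by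
    intro i hi v
    have := (abs_lt.1 (hc i hi v)).2
    have h2 := Nat.le_ceil (c i)
    have : (dg (rawF G s b i) v : ℝ) ≤ ⌈c i⌉₊ + E := by linarith
    exact_mod_cast this
  have hc2 : ∀ i < m, ∀ v, ⌈c i⌉₊ ≤ dg (rawF G s b i) v + E := by
    intro i hi v
    have := (abs_lt.1 (hc i hi v)).1
    apply Nat.ceil_le.2
    push_cast
    linarith
  have hL : ∀ i < m, 0 < i → ∀ v, d / 8 - E ≤ cnt (fun u => G.Adj v u ∧ s v = s u ∧ b 0 v ≠ b 0 u ∧ b i v ≠ b i u) := by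
    intro i hi hi0 v
    have := (abs_lt.1 (H3 i hi hi0 v)).1
    have h2 : ((d / 8 : ℕ) : ℝ) ≤ d / 8 := Nat.cast_div_le
    have h3 : ((d / 8 : ℕ) : ℝ) ≤ cnt (fun u => G.Adj v u ∧ s v = s u ∧ b 0 v ≠ b 0 u ∧ b i v ≠ b i u) + E := by linarith
    have h4 : d / 8 ≤ cnt (fun u => G.Adj v u ∧ s v = s u ∧ b 0 v ≠ b 0 u ∧ b i v ≠ b i u) + E := by exact_mod_cast h3
    omega
  have hΔ : ∀ i < m, 0 < i → ∀ v, cnt (fun u => G.Adj v u ∧ s v = s u ∧ b 0 v ≠ b 0 u ∧ b i v ≠ b i u) ≤ d / 8 + E + 1 := by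
    intro i hi hi0 v
    have := (abs_lt.1 (H3 i hi hi0 v)).2
    have h1 : d ≤ 8 * (d / 8) + 8 := by omega
    have h2 : (d : ℝ) ≤ 8 * ((d / 8 : ℕ) : ℝ) + 8 := by exact_mod_cast h1
    have h3 : (cnt (fun u => G.Adj v u ∧ s v = s u ∧ b 0 v ≠ b 0 u ∧ b i v ≠ b i u) : ℝ) ≤ ((d / 8 : ℕ) : ℝ) + E + 1 := by linarith
    exact_mod_cast h3
  have hmk : m * (4 * (2 * E)) = 8 * (m * E) := by ring
  obtain ⟨F, f1, f2, f3, f4, f5⟩ := balance G d hreg s b m _ (by omega) hh0 hss hdiff (2 * E) (d / 8 - E) (d / 8 + E + 1)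
    (4 * (2 * E)) (by omega) rfl (by rw [hmk]; omega)
    (fun i hi v w => by have := hc1 i hi v; have := hc2 i hi w; omega)
    hL hΔ
  refine assembly G d hmix hn hreg m s b hcl hcc (191 * (m * E)) (210 * (m * E)) ?_ (by omega) hG F
    (fun i => ⌈c i⌉₊ + 200 * (m * E)) f1 f2 f3 ?_ f5
  · have : m * (210 * (m * E)) * 100 ≤ d := by
      refine le_trans (le_of_eq ?_) hd
      ring
    have : (m : ℝ) * ((210 * (m * E) : ℕ) : ℝ) * 100 ≤ d := by exact_mod_cast this
    linarith
  · intro i hi v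
    have h1 := hc1 i hi v
    have h2 := hc2 i hi v
    have h3 := f4 i hi v
    rw [hmk] at h3
    omega

/-- subcubes -/
noncomputable def sbox {M : ℕ} (T : Finset (Fin M)) (a : Fin M → Bool) : Finset (Fin M → Bool) :=
  Fintype.piFinset (fun j => if j ∈ T then {a j} else univ)

lemma mem_sbox {M : ℕ} (T : Finset (Fin M)) (a δ : Fin M → Bool) : δ ∈ sbox T a ↔ ∀ j ∈ T, δ j = a j := by
  unfold sbox
  rw [Fintype.mem_piFinset]
  refine forall_congr' fun j => ?_
  by_cases h : j ∈ T <;> simp [h]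

lemma card_sbox {M : ℕ} (T : Finset (Fin M)) (a : Fin M → Bool) :
    ((sbox T a).card : ℝ) / 2 ^ M = 1 / 2 ^ T.card := by
  have h : (sbox T a).card * 2 ^ T.card = 2 ^ M := by
    unfold sbox
    rw [Fintype.card_piFinset]
    have : ∀ j, (if j ∈ T then ({a j} : Finset Bool) else univ).card = if j ∈ T then 1 else 2 := by
      intro j
      split_ifs <;> simp
    simp only [this]
    rw [Finset.prod_ite]
    simp only [prod_const, one_pow, one_mul]
    rw [← pow_add]
    congr 1
    have h1 := Finset.card_filter_add_card_filter_not (s := (univ : Finset (Fin M))) (fun j => j ∈ T)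
    have h2 : univ.filter (fun j => j ∈ T) = T := by ext; simp
    rw [h2] at h1
    simp only [card_univ, Fintype.card_fin] at h1
    omega
  have h' : ((sbox T a).card : ℝ) * 2 ^ T.card = 2 ^ M := by exact_mod_cast h
  rw [div_eq_div_iff (by positivity) (by positivity), h', one_mul]

/-- bits of the difference -/
noncomputable def bt {V ι : Type*} {m : ℕ} (e : V ≃ ι × Bool) (ω : ι → (Fin (m + 1) → Bool)) (i : ℕ) (v : V) : Bool :=
  if h : i + 1 < m + 1 then lab e ω v ⟨i + 1, h⟩ else false

lemma prob_main {V ι : Type*} [Fintype V] [Fintype ι] (e : V ≃ ι × Bool) (G : SimpleGraph V) (d : ℕ) (hmix : Mix G d)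
    (hn : (0 : ℝ) < Fintype.card V) (hreg : ∀ v, dg G v = d) (m : ℕ) (hm : 1 ≤ m)
    (E : ℕ) (hE : 1 ≤ E) (hd : 21000 * (m * (m * E)) ≤ d)
    (hnum : 4 * ((6 * (m + 1) : ℕ) * (2 * Real.exp (-(((E : ℝ) - 1) ^ 2 / (4 * d)))) + d * (1 / 2 ^ (m + 1))) * (2 * ((d : ℝ) + 1) ^ 2) ≤ 1) :
    Fac G d := by
  have hmE : 1 ≤ m * (m * E) := by
    have : 0 < m * (m * E) := by positivity
    omega
  have h1m : 1 < m + 1 := by omega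
  let J := Fin (m + 1) ⊕ (Fin (m + 1) × Bool × Bool) ⊕ Fin (m + 1)
  have hJ : Fintype.card J = 6 * (m + 1) := by
    simp [J]; ring
  let Q : J → Finset (Fin (m + 1) → Bool) := fun j => match j with
    | Sum.inl i => sbox (univ.filter (fun j => j ≤ i)) (fun j => decide (j = i))
    | Sum.inr (Sum.inl (i, a, c)) => sbox {0, i} (fun j => if j = 0 then a else c)
    | Sum.inr (Sum.inr i) => sbox {0, ⟨1, h1m⟩, i} (fun j => decide (j ≠ 0))
  obtain ⟨ω, hω1, hω2⟩ := labels_exist (M := m + 1) (by omega) e G d (by omega) hreg Q E (by exact_mod_cast hE)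
    (by rw [hJ]; exact hnum)
  have hcard : ∀ v j, |(cnt (fun u => G.Adj v u ∧ dl e ω v u ∈ Q j) : ℝ) - d * (((Q j).card : ℝ) / 2 ^ (m + 1))| < E := by
    intro v j
    have := hω2 v j
    convert this using 4
    unfold cnt
    congr!
  clear hω2
  let p : V ≃ V := (e.trans (Equiv.prodCongr (Equiv.refl ι) Equiv.boolNot)).trans e.symm
  have hp : ∀ v j, lab e ω (p v) j = !lab e ω v j := by
    intro v j
    simp [lab, p]
  have hb : ∀ i (hi : i < m) v, bt e ω i v = lab e ω v ⟨i + 1, by omega⟩ := by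
    intro i hi v
    simp [bt, hi]
  refine det_main G d hmix hn hreg m hm (fun v => lab e ω v 0) (bt e ω) p (fun v => hp v 0) ?_ ?_ E hE hd ?_ ?_ ?_
  · intro i hi v
    rw [hb i hi, hb i hi, hp]
  · intro u v huv hs
    have := hω1 u v huv
    by_contra hcon
    push Not at hcon
    apply this
    funext j
    rcases Fin.eq_zero_or_eq_succ j with rfl | ⟨k, rfl⟩
    · exact hs.symm
    · have := hcon k k.2
      rw [hb _ k.2, hb _ k.2] at this
      exact this.symm
  · intro i hi
    refine ⟨(d : ℝ) * (((Q (Sum.inl ⟨i + 1, by omega⟩)).card : ℝ) / 2 ^ (m + 1)), ?_, fun v => ?_⟩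
    rotate_left
    · have := hcard v (Sum.inl ⟨i + 1, by omega⟩)
      rwa [show dg (rawF G (fun v => lab e ω v 0) (bt e ω) i) v = cnt (fun u => G.Adj v u ∧ dl e ω v u ∈ Q (Sum.inl ⟨i + 1, by omega⟩)) from ?_]
      apply cnt_congr
      intro u
      simp only [rawF, Q, mem_sbox, mem_filter, mem_univ, true_and]
      refine and_congr_right fun _ => ?_
      constructor
      · rintro ⟨h1, h2, h3⟩ j hj
        rw [hb i hi, hb i hi] at h2
        rcases Fin.eq_zero_or_eq_succ j with rfl | ⟨k, rfl⟩
        · have : (0 : Fin (m + 1)) ≠ ⟨i + 1, by omega⟩ := by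
            intro h; have := congrArg Fin.val h; simp at this
          simp [dl, h1, this]
        · by_cases hk : (k : ℕ) = i
          · have : Fin.succ k = ⟨i + 1, by omega⟩ := by ext; simp [hk]
            rw [this]
            simpa [dl] using h2
          · have hki : (k : ℕ) < i := by
              have : (k : ℕ) + 1 ≤ i + 1 := hj
              omega
            have h4 := h3 k hki
            rw [hb _ k.2, hb _ k.2] at h4
            have h5 : Fin.succ k ≠ ⟨i + 1, by omega⟩ := by
              intro h; have := congrArg Fin.val h; simp at this; omega
            have h6 : lab e ω v k.succ = lab e ω u k.succ := h4
            simp [dl, h6, h5]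
      · intro h
        refine ⟨?_, ?_, ?_⟩
        · have h4 := h 0 (Fin.zero_le _)
          have : (0 : Fin (m + 1)) ≠ ⟨i + 1, by omega⟩ := by
            intro h; have := congrArg Fin.val h; simp at this
          simpa [dl, this] using h4
        · rw [hb i hi, hb i hi]
          have h4 := h ⟨i + 1, by omega⟩ le_rfl
          simpa [dl] using h4
        · intro j hj
          rw [hb j (by omega), hb j (by omega)]
          have h4 := h ⟨j + 1, by omega⟩ (by show j + 1 ≤ i + 1; omega)
          have : (⟨j + 1, by omega⟩ : Fin (m + 1)) ≠ ⟨i + 1, by omega⟩ := by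
            intro h; have := congrArg Fin.val h; simp at this; omega
          simpa [dl, this] using h4
    · positivity
  · intro i hi x y v
    have h0 : (0 : Fin (m + 1)) ≠ ⟨i + 1, by omega⟩ := by
      intro h; have := congrArg Fin.val h; simp at this
    have := hcard v (Sum.inr (Sum.inl (⟨i + 1, by omega⟩, xor (lab e ω v 0) x, xor (bt e ω i v) y)))
    rw [cnt_congr (Q := fun u => G.Adj v u ∧ lab e ω u 0 = x ∧ bt e ω i u = y)] at this
    · simp only [Q] at this
      rw [card_sbox, card_pair h0] at this
      convert this using 3
      ring
    · intro u
      refine and_congr_right fun _ => ?_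
      rw [hb i hi, hb i hi]
      simp only [Q, mem_sbox, mem_insert, mem_singleton, forall_eq_or_imp, forall_eq, dl, if_true, h0.symm, if_false]
      refine and_congr ?_ ?_
      · cases lab e ω v 0 <;> cases lab e ω u 0 <;> cases x <;> decide
      · cases lab e ω v ⟨i + 1, by omega⟩ <;> cases lab e ω u ⟨i + 1, by omega⟩ <;> cases y <;> decide
  · intro i hi hi0 v
    have h0 : (0 : Fin (m + 1)) ≠ ⟨i + 1, by omega⟩ := by
      intro h; have := congrArg Fin.val h; simp at this
    have h1 : (0 : Fin (m + 1)) ≠ ⟨1, h1m⟩ := by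
      intro h; have := congrArg Fin.val h; simp at this
    have h2 : (⟨1, h1m⟩ : Fin (m + 1)) ≠ ⟨i + 1, by omega⟩ := by
      intro h; have := congrArg Fin.val h; simp at this; omega
    have := hcard v (Sum.inr (Sum.inr ⟨i + 1, by omega⟩))
    rw [cnt_congr (Q := fun u => G.Adj v u ∧ lab e ω v 0 = lab e ω u 0 ∧ bt e ω 0 v ≠ bt e ω 0 u ∧ bt e ω i v ≠ bt e ω i u)] at this
    · simp only [Q] at this
      rw [card_sbox, card_eq_three.2 ⟨_, _, _, h1, h0, h2, rfl⟩] at this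
      convert this using 3
      ring
    · intro u
      refine and_congr_right fun _ => ?_
      rw [hb i hi, hb i hi, hb 0 hm, hb 0 hm]
      simp only [Q, mem_sbox, mem_insert, mem_singleton, forall_eq_or_imp, forall_eq, dl]
      refine and_congr ?_ (and_congr ?_ ?_)
      · cases lab e ω v 0 <;> cases lab e ω u 0 <;> simp
      · simp [h1.symm]
      · simp [h0.symm]

lemma numerics : ∃ k0 : ℕ, 1 ≤ k0 ∧ ∀ k : ℕ, k0 ≤ k → ∀ d : ℕ, k ^ 10 ≤ d → d < (k + 1) ^ 10 →
    21000 * (k * (k * (64 * k ^ 6 + 1))) ≤ d ∧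
    4 * ((6 * (k + 1) : ℕ) * (2 * Real.exp (-((((64 * k ^ 6 + 1 : ℕ) : ℝ) - 1) ^ 2 / (4 * d)))) + d * (1 / 2 ^ (k + 1))) *
      (2 * ((d : ℝ) + 1) ^ 2) ≤ 1 := by
  have ht := tendsto_pow_const_div_const_pow_of_one_lt 30 (one_lt_two : (1 : ℝ) < 2)
  have hev := ht.eventually (ge_mem_nhds (show (0 : ℝ) < 1 / 10 ^ 10 by positivity))
  obtain ⟨k1, hk1⟩ := Filter.eventually_atTop.1 hev
  refine ⟨max k1 1200, le_trans (by norm_num) (le_max_right _ _), ?_⟩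
  intro k hk d hd1 hd2
  have hkk1 : k1 ≤ k := le_trans (le_max_left _ _) hk
  have hk12 : 1200 ≤ k := le_trans (le_max_right _ _) hk
  have hk0 := hk1 k hkk1
  constructor
  · refine le_trans ?_ hd1
    have h1 : 1 ≤ k ^ 6 := Nat.one_le_pow _ _ (by omega)
    calc 21000 * (k * (k * (64 * k ^ 6 + 1))) ≤ 21000 * (k * (k * (65 * k ^ 6))) := by gcongr; omega
      _ = 1365000 * k ^ 8 := by ring
      _ ≤ (k * k) * k ^ 8 := by gcongr; nlinarith
      _ = k ^ 10 := by ring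
  · have hkR : (1 : ℝ) ≤ k := by exact_mod_cast (by omega : 1 ≤ k)
    have hk0' : (0 : ℝ) < k := by linarith
    have hdk : (d : ℝ) ≤ 1024 * (k : ℝ) ^ 10 := by
      have : d ≤ 1024 * k ^ 10 := by
        calc d ≤ (k + 1) ^ 10 := hd2.le
          _ ≤ (2 * k) ^ 10 := by gcongr; omega
          _ = 1024 * k ^ 10 := by ring
      exact_mod_cast this
    have hk10 : (1 : ℝ) ≤ (k : ℝ) ^ 10 := one_le_pow₀ hkR
    have hd0 : (0 : ℝ) < d := by
      have : ((k ^ 10 : ℕ) : ℝ) ≤ d := by exact_mod_cast hd1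
      push_cast at this
      linarith
    set q : ℝ := 1 / 2 ^ k with hq
    have hq0 : 0 < q := by positivity
    have hexp : Real.exp (-((((64 * k ^ 6 + 1 : ℕ) : ℝ) - 1) ^ 2 / (4 * d))) ≤ q := by
      have h1 : (k : ℝ) ≤ (((64 * k ^ 6 + 1 : ℕ) : ℝ) - 1) ^ 2 / (4 * d) := by
        rw [le_div_iff₀ (by positivity)]
        push_cast
        have h2 : (64 * (k : ℝ) ^ 6 + 1 - 1) ^ 2 = 4096 * (k : ℝ) ^ 10 * (k * k) := by ring
        rw [h2]
        have h3 : (k : ℝ) * (4 * d) ≤ k * (4 * (1024 * (k : ℝ) ^ 10)) := by gcongr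
        have h4 : (k : ℝ) * (4 * (1024 * (k : ℝ) ^ 10)) = 4096 * (k : ℝ) ^ 10 * (k * 1) := by ring
        rw [h4] at h3
        refine h3.trans ?_
        gcongr
      have h5 : (2 : ℝ) ≤ Real.exp 1 := by have := Real.add_one_le_exp (1 : ℝ); linarith
      calc _ ≤ Real.exp (-(k : ℝ)) := Real.exp_le_exp.2 (by linarith)
        _ = (Real.exp 1 ^ k)⁻¹ := by rw [Real.exp_neg, ← Real.exp_nat_mul, mul_one]
        _ ≤ ((2 : ℝ) ^ k)⁻¹ := by gcongr
        _ = q := by rw [hq, one_div]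
    have hq2 : (1 : ℝ) / 2 ^ (k + 1) ≤ q := by
      rw [hq, pow_succ]
      apply one_div_le_one_div_of_le (by positivity)
      have : (0 : ℝ) < 2 ^ k := by positivity
      linarith
    have hkp : (k : ℝ) ≤ (k : ℝ) ^ 10 := by
      calc (k : ℝ) = (k : ℝ) ^ 1 := by ring
        _ ≤ (k : ℝ) ^ 10 := pow_le_pow_right₀ hkR (by norm_num)
    have hd1' : (d : ℝ) + 1 ≤ 1025 * (k : ℝ) ^ 10 := by linarith
    have h6 : ((6 * (k + 1) : ℕ) : ℝ) ≤ 12 * (k : ℝ) ^ 10 := by push_cast; linarith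
    have hkq : (k : ℝ) ^ 30 * q ≤ 1 / 10 ^ 10 := by
      have : (k : ℝ) ^ 30 * q = (k : ℝ) ^ 30 / 2 ^ k := by rw [hq]; ring
      rw [this]; exact hk0
    calc _ ≤ 4 * ((12 * (k : ℝ) ^ 10) * (2 * q) + (1024 * (k : ℝ) ^ 10) * q) * (2 * (1025 * (k : ℝ) ^ 10) ^ 2) := by
          gcongr
      _ = (4 * 1048 * 2 * 1025 ^ 2) * ((k : ℝ) ^ 30 * q) := by ring
      _ ≤ (4 * 1048 * 2 * 1025 ^ 2) * (1 / 10 ^ 10) := by gcongr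
      _ ≤ 1 := by norm_num

lemma dg_eq_degree {V : Type*} [Fintype V] (G : SimpleGraph V) (v : V) : dg G v = G.degree v := by
  unfold dg
  rw [← SimpleGraph.card_neighborFinset_eq_degree]
  congr 1
  ext u
  simp

lemma fac_main : ∃ d₀ : ℕ, ∀ d : ℕ, d₀ ≤ d → ∀ n : ℕ, Even n → d + 1 ≤ n →
      ∀ G : SimpleGraph (Fin n), G.IsRegularOfDegree d →
      ∀ hA : (SimpleGraph.adjMatrix ℝ G).IsHermitian,
      ∀ i₀ : Fin n, hA.eigenvalues i₀ = d →
      (∀ i, i ≠ i₀ → |hA.eigenvalues i| ≤ (d : ℝ) / 12) → Fac G d := by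
  obtain ⟨k0, hk0, hnum⟩ := numerics
  refine ⟨k0 ^ 10, ?_⟩
  intro d hd n hn hdn G hG hA i₀ hi₀ hl
  have hd1 : 1 ≤ d := le_trans (Nat.one_le_pow _ _ (by omega)) hd
  obtain ⟨k, hkk, hk1, hk2⟩ : ∃ k, k0 ≤ k ∧ k ^ 10 ≤ d ∧ d < (k + 1) ^ 10 := by
    have hself : ∀ x : ℕ, x ≤ x ^ 10 := fun x => Nat.le_self_pow (by norm_num) x
    refine ⟨Nat.findGreatest (fun k => k ^ 10 ≤ d) d, ?_, ?_, ?_⟩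
    · exact Nat.le_findGreatest ((hself k0).trans hd) hd
    · exact Nat.findGreatest_spec (P := fun k => k ^ 10 ≤ d) (m := 0) (Nat.zero_le _) (by simp)
    · by_contra hcon
      push Not at hcon
      have := Nat.le_findGreatest (P := fun k => k ^ 10 ≤ d) ((hself _).trans hcon) hcon
      omega
  obtain ⟨hn1, hn2⟩ := hnum k hkk d hk1 hk2
  have hreg : ∀ v, dg G v = d := by
    intro v
    rw [dg_eq_degree, ← hG v]
  obtain ⟨h, rfl⟩ := hn
  let e : Fin (h + h) ≃ Fin h × Bool := Fintype.equivOfCardEq (by simp; ring)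
  refine prob_main e G d ?_ ?_ hreg k (by omega) (64 * k ^ 6 + 1) (by omega) hn1 hn2
  · intro S T
    have := mixing G d hd1 hreg hA i₀ hi₀ hl S T
    rw [Fintype.card_fin]
    exact this
  · rw [Fintype.card_fin]
    exact_mod_cast (by omega : 0 < h + h)

end helpers

theorem stmt_12 :
    ∃ d₀ : ℕ, ∀ d : ℕ, d₀ ≤ d → ∀ n : ℕ, Even n → d + 1 ≤ n →
      ∀ G : SimpleGraph (Fin n), G.IsRegularOfDegree d →
      ∀ hA : (SimpleGraph.adjMatrix ℝ G).IsHermitian,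
      ∀ i₀ : Fin n, hA.eigenvalues i₀ = d →
      (∀ i, i ≠ i₀ → |hA.eigenvalues i| ≤ (d : ℝ) / 12) →
      ∃ Ms : Fin d → SimpleGraph (Fin n),
        (∀ i j, i ≠ j → Disjoint (Ms i).edgeSet (Ms j).edgeSet) ∧
        (⋃ i, (Ms i).edgeSet) = G.edgeSet ∧
        (∀ i, (Ms i).IsRegularOfDegree 1) := by
  obtain ⟨d₀, h₀⟩ := fac_main
  refine ⟨d₀, ?_⟩
  intro d hd n hn hdn G hG hA i₀ hi₀ hl
  obtain ⟨c, c1, c2, c3⟩ := h₀ d hd n hn hdn G hG hA i₀ hi₀ hl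
  let Ms : Fin d → SimpleGraph (Fin n) := fun i =>
    { Adj := fun u v => G.Adj u v ∧ c u v = i
      symm := ⟨fun u v h => ⟨h.1.symm, (c1 v u).trans h.2⟩⟩
      loopless := ⟨fun u h => G.loopless.irrefl u h.1⟩ }
  refine ⟨Ms, ?_, ?_, ?_⟩
  · intro i j hij
    rw [Set.disjoint_left]
    intro e
    induction e using Sym2.ind with
    | _ u v =>
      intro h1 h2
      rw [SimpleGraph.mem_edgeSet] at h1 h2
      exact hij (Fin.ext (h1.2.symm.trans h2.2))
  · ext e
    induction e using Sym2.ind with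
    | _ u v =>
      simp only [Set.mem_iUnion, SimpleGraph.mem_edgeSet]
      constructor
      · rintro ⟨i, h⟩
        exact h.1
      · intro h
        exact ⟨⟨c u v, c2 u v h⟩, h, rfl⟩
  · intro i v
    obtain ⟨u, hu, huu⟩ := c3 v i i.2
    rw [← dg_eq_degree]
    unfold dg
    rw [Finset.card_eq_one]
    refine ⟨u, ?_⟩
    ext w
    simp only [Finset.mem_filter, Finset.mem_univ, true_and, Finset.mem_singleton]
    constructor
    · intro h; exact huu w h
    · rintro rfl; exact hu
end

section
/- Let G be an (n,d,λ)-graph with λ ≤ d/12, let F be a subgraph of G with maximum degree at most ρd where ρ ≤ 1/100, and let X', Y' be disjoint vertex subsets with every vertex of Y' having at least d/5 neighbors in X' within G. Then for any T ⊆ Y' with |T| ≤ n/10 and any S ⊆ X' with (1-γ)|X' \ S| < |T| for some γ ≤ 1/30, the graph G minus the edges of F satisfies e_{G\F}(S, T) ≥ α d |T| for α = 1/200. (That is, the Ore-type deficiency condition cannot fail on small sets.) -/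
open scoped Classical

lemma aux_quad {V : Type*} [Fintype V] [DecidableEq V] (A : Matrix V V ℝ)
    (hA : A.IsHermitian) (d μ : ℝ) (hμ0 : 0 ≤ μ) (hμ : μ < d) (h1 : A.mulVec (fun _ => 1) = fun _ => d)
    (i₀ : V) (hlam : ∀ i, i ≠ i₀ → |hA.eigenvalues i| ≤ μ)
    (f g : V → ℝ) (hf : ∑ x, f x = 0) :
    f ⬝ᵥ (A.mulVec g) ≤ μ / 2 * (f ⬝ᵥ f + g ⬝ᵥ g) := by
  have hsym : A.transpose = A := by
    have := hA.eq
    rwa [Matrix.conjTranspose_eq_transpose_of_trivial] at this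
  have hswap : ∀ a b : V → ℝ, a ⬝ᵥ (A.mulVec b) = (A.mulVec a) ⬝ᵥ b := by
    intro a b
    rw [Matrix.dotProduct_mulVec, ← Matrix.mulVec_transpose, hsym]
  let v : V → V → ℝ := fun i => (hA.eigenvectorBasis i).ofLp
  have hv : ∀ i, A.mulVec (v i) = hA.eigenvalues i • v i := fun i => hA.mulVec_eigenvectorBasis i
  have hpars : ∀ a b : V → ℝ, ∑ i, (a ⬝ᵥ v i) * (v i ⬝ᵥ b) = a ⬝ᵥ b := by
    intro a b
    have := hA.eigenvectorBasis.sum_inner_mul_inner (WithLp.toLp 2 a) (WithLp.toLp 2 b)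
    simp only [EuclideanSpace.inner_eq_star_dotProduct, star_trivial] at this
    rw [dotProduct_comm a b, ← this]
    refine Finset.sum_congr rfl fun i _ => ?_
    rw [dotProduct_comm a, dotProduct_comm (v i) b]
  have hone : ∀ i, i ≠ i₀ → (fun _ => (1:ℝ)) ⬝ᵥ v i = 0 := by
    intro i hi
    have h := hswap (fun _ => (1:ℝ)) (v i)
    rw [hv, h1, dotProduct_smul] at h
    have h2 : (fun _ : V => d) ⬝ᵥ v i = d * ((fun _ => (1:ℝ)) ⬝ᵥ v i) := by
      simp [dotProduct, Finset.mul_sum]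
    rw [h2, smul_eq_mul] at h
    have h3 : hA.eigenvalues i < d := lt_of_le_of_lt ((le_abs_self _).trans (hlam i hi)) hμ
    have h4 : (d - hA.eigenvalues i) * ((fun _ => (1:ℝ)) ⬝ᵥ v i) = 0 := by linarith
    rcases mul_eq_zero.1 h4 with h5 | h5
    · linarith
    · exact h5
  have hf0 : f ⬝ᵥ v i₀ = 0 := by
    have e1 := hpars (fun _ => 1) f
    have e2 := hpars (fun _ => 1) (fun _ => 1)
    rw [Finset.sum_eq_single i₀ (fun i _ hi => by rw [hone i hi, zero_mul]) (by simp)] at e1 e2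
    have e3 : (fun _ : V => (1:ℝ)) ⬝ᵥ f = 0 := by simpa [dotProduct] using hf
    have e4 : (fun _ : V => (1:ℝ)) ⬝ᵥ (fun _ => 1) = Fintype.card V := by simp [dotProduct]
    have e5 : (0:ℝ) < Fintype.card V := by
      exact_mod_cast Fintype.card_pos_iff.2 ⟨i₀⟩
    rw [e3] at e1
    rw [e4] at e2
    rcases mul_eq_zero.1 e1 with h | h
    · rw [h, zero_mul] at e2; linarith
    · rw [dotProduct_comm]; exact h
  rw [← hpars f (A.mulVec g), ← hpars f f, ← hpars g g, ← Finset.sum_add_distrib, Finset.mul_sum]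
  refine Finset.sum_le_sum fun i _ => ?_
  rw [hswap, hv, smul_dotProduct, smul_eq_mul, dotProduct_comm (v i) f, dotProduct_comm (v i) g]
  by_cases hi : i = i₀
  · subst hi
    rw [hf0]
    have := mul_self_nonneg (g ⬝ᵥ v i)
    simp only [zero_mul, zero_add]
    positivity
  · have h := hlam i hi
    have hab : ∀ p q l : ℝ, |l| ≤ μ → p * (l * q) ≤ μ / 2 * (p * p + q * q) := by
      intro p q l hl
      obtain ⟨h1, h2⟩ := abs_le.1 hl
      nlinarith [mul_nonneg (sub_nonneg.2 h2) (sq_nonneg (p + q)),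
        mul_nonneg (by linarith : 0 ≤ μ + l) (sq_nonneg (p - q))]
    exact hab _ _ _ h

lemma aux_num0 (τ a : ℝ) (hτ0 : 0 ≤ τ) (hτ1 : 10 * τ ≤ 1) (ha1 : 29 * a ≤ 30 * τ) :
    a * τ + 1/24 * ((τ - τ^2) + (a - a^2)) ≤ 37/200 * τ := by
  have h1 := mul_nonneg hτ0 (sub_nonneg.2 hτ1)
  have h2 := mul_nonneg hτ0 (sub_nonneg.2 ha1)
  have h3 := sq_nonneg τ
  have h4 := sq_nonneg a
  nlinarith only [h1, h2, h3, h4, ha1]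

lemma aux_num (n t u : ℝ) (hn : 0 < n) (ht0 : 0 ≤ t) (hu0 : 0 ≤ u)
    (h10 : 10 * t ≤ n) (hut : 29 * u ≤ 30 * t) :
    u * t / n + 1 / 24 * ((t - t^2/n) + (u - u^2/n)) ≤ 37/200 * t := by
  have main := aux_num0 (t / n) (u / n) (by positivity)
    (by rw [← mul_div_assoc, div_le_one hn]; exact h10)
    (by rw [← mul_div_assoc, ← mul_div_assoc]; gcongr)
  have h := mul_le_mul_of_nonneg_left main hn.le
  have e : u * t / n + 1 / 24 * ((t - t^2/n) + (u - u^2/n))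
      = n * (u / n * (t / n) + 1/24 * ((t / n - (t / n)^2) + (u / n - (u / n)^2))) := by
    field_simp
  have e2 : n * (37/200 * (t / n)) = 37/200 * t := by field_simp
  rw [e, ← e2]
  exact h

theorem stmt_15 {V : Type*} [Fintype V] [DecidableEq V] (G : SimpleGraph V)
    [DecidableRel G.Adj] (d : ℕ) (lam ρ γ : ℝ)
    (hreg : G.IsRegularOfDegree d)
    (hA : (SimpleGraph.adjMatrix ℝ G).IsHermitian)
    (i₀ : V) (hi₀ : hA.eigenvalues i₀ = d)
    (hlam : ∀ i, i ≠ i₀ → |hA.eigenvalues i| ≤ lam)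
    (hlamd : lam ≤ (d : ℝ) / 12)
    (hρ : ρ ≤ 1 / 100)
    (F : SimpleGraph V) (hF : F ≤ G) (hFdeg : ∀ v, (F.degree v : ℝ) ≤ ρ * d)
    (X' Y' : Finset V) (hdisj : Disjoint X' Y')
    (hdeg : ∀ y ∈ Y', (d : ℝ) ≤ 5 * ((X'.filter (G.Adj y)).card : ℝ))
    (T : Finset V) (hT : T ⊆ Y') (hTsize : 10 * (T.card : ℝ) ≤ (Fintype.card V : ℝ))
    (S : Finset V) (hS : S ⊆ X')
    (hγ : 0 < γ) (hγ' : γ ≤ 1 / 30)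
    (hST : (1 - γ) * (((X' \ S).card : ℝ)) < (T.card : ℝ)) :
    (1 / 200 : ℝ) * d * T.card ≤
      (((S ×ˢ T).filter fun p => (G \ F).Adj p.1 p.2).card : ℝ) := by
  rcases Nat.eq_zero_or_pos d with hd0 | hdpos
  · subst hd0; simp
  have hd : (0:ℝ) < d := by exact_mod_cast hdpos
  set n : ℝ := (Fintype.card V : ℝ) with hn
  have hnpos : 0 < n := by
    rw [hn]; exact_mod_cast Fintype.card_pos_iff.2 ⟨i₀⟩
  set U := X' \ S with hU
  set t : ℝ := (T.card : ℝ) with ht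
  set u : ℝ := (U.card : ℝ) with hu
  have ht0 : 0 ≤ t := by positivity
  have hu0 : 0 ≤ u := by positivity
  have hut : 29 * u ≤ 30 * t := by nlinarith
  -- counting
  have hcount : (((S ×ˢ T).filter fun p => (G \ F).Adj p.1 p.2).card : ℝ)
      = ∑ y ∈ T, ((S.filter fun x => (G \ F).Adj x y).card : ℝ) := by
    rw [Finset.card_filter, Finset.sum_product_right]
    push_cast
    refine Finset.sum_congr rfl fun y _ => ?_
    rw [Finset.card_filter]; push_cast; rfl
  have hpt : ∀ y ∈ T, (d:ℝ) * (19 / 100) - ((U.filter (G.Adj y)).card : ℝ)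
      ≤ ((S.filter fun x => (G \ F).Adj x y).card : ℝ) := by
    intro y hy
    have h1 := hdeg y (hT hy)
    have h2 := hFdeg y
    have hsub : X'.filter (G.Adj y) ⊆
        (S.filter fun x => (G \ F).Adj x y) ∪ (U.filter (G.Adj y)) ∪ F.neighborFinset y := by
      intro x hx
      simp only [Finset.mem_filter, Finset.mem_union, SimpleGraph.mem_neighborFinset,
        SimpleGraph.sdiff_adj, hU, Finset.mem_sdiff] at hx ⊢
      have := hx.2.symm
      have hc := F.adj_comm x y
      tauto
    have h3 := (Finset.card_le_card hsub).trans ((Finset.card_union_le _ _).trans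
      (Nat.add_le_add_right (Finset.card_union_le _ _) _))
    rw [SimpleGraph.card_neighborFinset_eq_degree] at h3
    have h3' : ((X'.filter (G.Adj y)).card : ℝ) ≤ ((S.filter fun x => (G \ F).Adj x y).card : ℝ)
      + ((U.filter (G.Adj y)).card : ℝ) + (F.degree y : ℝ) := by exact_mod_cast h3
    nlinarith
  have hsum := Finset.sum_le_sum hpt
  rw [← hcount, Finset.sum_sub_distrib, Finset.sum_const, nsmul_eq_mul] at hsum
  -- expander mixing
  have h1 : (SimpleGraph.adjMatrix ℝ G).mulVec (fun _ => 1) = fun _ => (d:ℝ) := by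
    ext x
    have := hreg x
    simp [SimpleGraph.adjMatrix_mulVec_apply, this]
  have hq := aux_quad (SimpleGraph.adjMatrix ℝ G) hA d (d / 12) (by positivity) (by linarith) h1 i₀
    (fun i hi => (hlam i hi).trans hlamd)
    (fun x => (if x ∈ T then 1 else 0) - t / n) (fun x => (if x ∈ U then 1 else 0) - u / n)
    (by
      rw [Finset.sum_sub_distrib]
      simp
      field_simp
      simp [ht, hn]
      ring)
  have hsq : ∀ W : Finset V, (fun x => (if x ∈ W then (1:ℝ) else 0) - (W.card:ℝ) / n) ⬝ᵥ
      (fun x => (if x ∈ W then (1:ℝ) else 0) - (W.card:ℝ) / n)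
      = W.card - (W.card:ℝ)^2 / n := by
    intro W
    have : ∀ x, ((if x ∈ W then (1:ℝ) else 0) - (W.card:ℝ) / n) *
      ((if x ∈ W then (1:ℝ) else 0) - (W.card:ℝ) / n) =
      (1 - 2 * ((W.card:ℝ) / n)) * (if x ∈ W then (1:ℝ) else 0) + ((W.card:ℝ) / n)^2 := by
      intro x; split_ifs <;> ring
    simp only [dotProduct, this]
    rw [Finset.sum_add_distrib, ← Finset.mul_sum]
    simp
    rw [← hn]
    field_simp
    ring
  have hmul : (SimpleGraph.adjMatrix ℝ G).mulVec (fun x => (if x ∈ U then (1:ℝ) else 0) - u / n)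
      = fun y => ((U.filter (G.Adj y)).card : ℝ) - d * (u / n) := by
    ext y
    have := hreg y
    rw [SimpleGraph.adjMatrix_mulVec_apply, Finset.sum_sub_distrib]
    simp only [Finset.sum_const, SimpleGraph.card_neighborFinset_eq_degree, this, nsmul_eq_mul]
    congr 1
    rw [← Finset.sum_filter, Finset.sum_const, nsmul_eq_mul, mul_one]
    congr 2
    ext x; simp [and_comm]
  have htot : ∑ y, ((U.filter (G.Adj y)).card : ℝ) = d * u := by
    have h := congrArg (fun w => (fun _ : V => (1:ℝ)) ⬝ᵥ w) hmul
    simp only [Matrix.dotProduct_mulVec] at h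
    rw [← Matrix.mulVec_transpose, SimpleGraph.transpose_adjMatrix, h1] at h
    simp only [dotProduct, one_mul, ← Finset.mul_sum, Finset.sum_sub_distrib] at h
    simp at h
    rw [← hn, ← hu] at h
    field_simp at h
    linarith
  have hT2 := hsq T
  have hU2 := hsq U
  rw [← ht] at hT2
  rw [← hu] at hU2
  rw [hT2, hU2, hmul] at hq
  have hlhs : (fun x => (if x ∈ T then (1:ℝ) else 0) - t / n) ⬝ᵥ
      (fun y => ((U.filter (G.Adj y)).card : ℝ) - d * (u / n))
      = ∑ y ∈ T, ((U.filter (G.Adj y)).card : ℝ) - d * u * t / n := by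
    simp only [dotProduct, sub_mul, Finset.sum_sub_distrib, ← Finset.mul_sum, mul_sub, htot]
    simp [ite_mul]
    rw [← hn, ← ht]
    field_simp
    ring
  rw [hlhs] at hq
  set E := ∑ y ∈ T, ((U.filter (G.Adj y)).card : ℝ)
  have key : u * t / n + 1 / 24 * ((t - t^2/n) + (u - u^2/n)) ≤ 37/200 * t := by
    exact aux_num n t u hnpos ht0 hu0 hTsize hut
  have hk := mul_le_mul_of_nonneg_left key hd.le
  have e6 : d * (u * t / n) = d * u * t / n := by ring
  nlinarith
end
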